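/- arXiv:1204.1657 — 6 statements merged into one kernel-verified Lean document; each statement's English description precedes it below -/
import Mathlib

section
/- Let A and B be real numbers with A > 2 and B ≥ 4A/(A−2), and set C = 1 − 2/A − 4/B. Let n be a positive integer that is not a prime power and has no prime divisor smaller than B. Let r and d be positive integers such that d·r·(1 − A/d) ≤ A²·C·log n/(2·log 2). Let S be a cyclic extension of ℤ/nℤ of dimension d with generator σ. Then the density of bad witnesses for the product of r Miller–Rabin tests and one Galois test of dimension d, namely #{(x_1,…,x_r,y) ∈ ((ℤ/nℤ)*)^r × S* : every x_i is a Miller–Rabin nonwitness for n and σ(y) = y^n} / ((#(ℤ/nℤ)*)^r · #S*), is at most 2^{−(r·d/A)·(1 − A/d)}. -/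
/-- For `n` odd with `n - 1 = m·2^k`, `m` odd: `x ∈ (ℤ/nℤ)ˣ` is a Miller–Rabin
nonwitness for `n` if `x^m = 1` or `x^(m·2^i) = -1` for some `0 ≤ i < k`. -/
def MRNonwitness (n m k : ℕ) (x : (ZMod n)ˣ) : Prop :=
  x ^ m = 1 ∨ ∃ i < k, x ^ (m * 2 ^ i) = -1

theorem charP_of_prime_cast_eq_zero {K : Type*} [Ring K] [Nontrivial K] {p : ℕ} (hp : p.Prime)
    (h : (p : K) = 0) : CharP K p :=
  (CharP.ringChar_of_prime_eq_zero hp h) ▸ inferInstance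

/-- Every automorphism of a finite field is a power of the Frobenius. -/
theorem FiniteField.exists_ringEquiv_eq_pow {K : Type*} [Field K] [Finite K] {p f : ℕ}
    (hp : p.Prime) [CharP K p] (hcard : Nat.card K = p ^ f) (τ : K ≃+* K) :
    ∃ a < f, ∀ z, τ z = z ^ p ^ a := by
  have : Fact p.Prime := ⟨hp⟩
  let := ZMod.algebra K p
  have hf : Module.finrank (ZMod p) K = f := by
    have := Module.natCard_eq_pow_finrank (K := ZMod p) (V := K)
    rw [hcard, Nat.card_zmod] at this
    exact (Nat.pow_right_injective hp.two_le this).symm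
  let τ' : K ≃ₐ[ZMod p] K := AlgEquiv.ofRingEquiv (f := τ) fun x => by
    rw [← ZMod.natCast_zmod_val x, map_natCast, map_natCast]
  obtain ⟨a, ha⟩ := (FiniteField.bijective_frobeniusAlgEquivOfAlgebraic_pow (ZMod p) K).2 τ'
  refine ⟨a, hf ▸ a.2, fun z => ?_⟩
  have := DFunLike.congr_fun ha z
  simp only [AlgEquiv.coe_pow, FiniteField.coe_frobeniusAlgEquivOfAlgebraic_iterate,
    ZMod.card] at this
  exact this.symm

theorem card_pow_eq_pow_le {K : Type*} [Field K] [Finite K] {s t : ℕ} (hst : s ≠ t) :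
    Nat.card {z : K // z ^ s = z ^ t} ≤ max s t := by
  classical
  cases nonempty_fintype K
  have hP : (Polynomial.X ^ s - Polynomial.X ^ t : Polynomial K) ≠ 0 := by
    intro h
    have := congrArg (fun P => Polynomial.coeff P s) h
    simp [Polynomial.coeff_X_pow, hst] at this
  have hsub : (Finset.univ.filter fun z : K => z ^ s = z ^ t) ⊆
      (Polynomial.X ^ s - Polynomial.X ^ t : Polynomial K).roots.toFinset := by
    intro z hz
    simp only [Finset.mem_filter, Finset.mem_univ, true_and] at hz
    rw [Multiset.mem_toFinset, Polynomial.mem_roots hP]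
    simp [hz]
  rw [Nat.card_eq_fintype_card, Fintype.card_subtype]
  refine (Finset.card_le_card hsub).trans <| (Multiset.toFinset_card_le _).trans <|
    (Polynomial.card_roots' _).trans <| (Polynomial.natDegree_sub_le _ _).trans ?_
  simp

/-- Solutions of `τ z = z ^ n` in a finite field of order `p ^ f`. -/
theorem FiniteField.card_ringEquiv_eq_pow_le {K : Type*} [Field K] [Finite K] {p f n : ℕ}
    (hp : p.Prime) [CharP K p] (hcard : Nat.card K = p ^ f) (τ : K ≃+* K)
    (hn : 1 < n) (hnpp : ¬ IsPrimePow n) :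
    Nat.card {z : K // τ z = z ^ n} ≤ n * p ^ (f / 2) := by
  obtain ⟨a, haf, ha⟩ := exists_ringEquiv_eq_pow hp hcard τ
  cases nonempty_fintype K
  have hp1 : 1 ≤ p ^ (f / 2) := Nat.one_le_pow _ _ hp.pos
  by_cases h : a ≤ f / 2
  · have hne : p ^ a ≠ n := by
      rintro rfl
      rcases Nat.eq_zero_or_pos a with rfl | h0
      · simp at hn
      · exact hnpp (hp.isPrimePow.pow h0.ne')
    have := card_pow_eq_pow_le (K := K) hne
    simp only [ha]
    refine this.trans (max_le ?_ ?_)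
    · exact (Nat.pow_le_pow_right hp.pos h).trans (Nat.le_mul_of_pos_left _ (by omega))
    · exact Nat.le_mul_of_pos_right _ hp1
  · have hle : n ≤ n * p ^ (f - a) := Nat.le_mul_of_pos_right _ (Nat.pow_pos hp.pos)
    have hne : n * p ^ (f - a) ≠ 1 := by omega
    have := card_pow_eq_pow_le (K := K) hne
    rw [max_eq_left (by omega)] at this
    refine le_trans (Nat.card_le_card_of_injective (Subtype.map id ?_)
      (Subtype.map_injective _ Function.injective_id))
      (this.trans (Nat.mul_le_mul_left _ (Nat.pow_le_pow_right hp.pos (by omega))))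
    intro z hz
    simp only [id]
    rw [ha] at hz
    rw [pow_mul, ← hz, ← pow_mul, ← pow_add, Nat.add_sub_cancel' haf.le, ← hcard,
      Nat.card_eq_fintype_card, FiniteField.pow_card, pow_one]

/-- The units `y` with `σ y = y ^ n`. -/
def galoisTestSubgroup {T : Type*} [CommRing T] (σ : T ≃+* T) (n : ℕ) : Subgroup Tˣ :=
  (Units.map (σ : T →* T)).eqLocus (powMonoidHom n)

theorem mem_galoisTestSubgroup {T : Type*} [CommRing T] {σ : T ≃+* T} {n : ℕ} {y : Tˣ} :
    y ∈ galoisTestSubgroup σ n ↔ σ (y : T) = (y : T) ^ n := by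
  change Units.map (σ : T →* T) y = y ^ n ↔ _
  rw [Units.ext_iff]
  simp

theorem iterate_of_mem_galoisTestSubgroup {T : Type*} [CommRing T] {σ : T ≃+* T} {n : ℕ} {y : Tˣ}
    (hy : y ∈ galoisTestSubgroup σ n) (i : ℕ) : σ^[i] (y : T) = (y : T) ^ n ^ i := by
  rw [mem_galoisTestSubgroup] at hy
  induction i with
  | zero => simp
  | succ i ih => rw [Function.iterate_succ_apply, hy, iterate_map_pow, ih, ← pow_mul, pow_succ]

theorem sub_pow_pow_mem_ideal_pow {T : Type*} [CommRing T] {J : Ideal T} {n : ℕ}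
    (hn : (n : T) ∈ J) {a b : T} (hab : a - b ∈ J) (i : ℕ) :
    a ^ n ^ i - b ^ n ^ i ∈ J ^ (i + 1) := by
  induction i with
  | zero => simpa using hab
  | succ i ih =>
    have hJ : a ^ n ^ i - b ^ n ^ i ∈ J := Ideal.pow_le_self (Nat.succ_ne_zero i) ih
    rw [pow_succ n, pow_mul, pow_mul, ← geom_sum₂_mul, mul_comm, pow_succ J]
    refine Ideal.mul_mem_mul ih ?_
    rw [← Ideal.Quotient.eq_zero_iff_mem] at hn ⊢
    rw [← Ideal.Quotient.eq] at hJ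
    rw [map_natCast] at hn
    simp only [map_sum, map_mul, map_pow] at hJ ⊢
    rw [hJ, geom_sum₂_self, hn, zero_mul]

theorem coe_ringEquiv_pow {T : Type*} [CommRing T] (σ : T ≃+* T) (i : ℕ) :
    ⇑((σ : RingAut T) ^ i) = σ^[i] := by
  induction i with
  | zero => rfl
  | succ i ih => rw [pow_succ, Function.iterate_succ, ← ih]; rfl

/-- An automorphism carrying `M'` to `M` induces an isomorphism of the quotients. -/
theorem exists_ringEquiv_quotient_apply {T : Type*} [CommRing T] (σ : T ≃+* T) {M M' : Ideal T}
    (h : ∀ x, x ∈ M' ↔ σ x ∈ M) :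
    ∃ τ : T ⧸ M' ≃+* T ⧸ M, ∀ x, τ (Ideal.Quotient.mk M' x) = Ideal.Quotient.mk M (σ x) := by
  refine ⟨Ideal.quotientEquiv M' M σ ?_, fun x => rfl⟩
  ext y
  rw [Ideal.mem_map_iff_of_surjective _ (by exact σ.surjective)]
  obtain ⟨x, rfl⟩ := σ.surjective y
  simp [h]

section

variable {T : Type*} [CommRing T] [Finite T] (σ : T ≃+* T)

theorem mem_nilradical_iff_forall_isMaximal {x : T} :
    x ∈ nilradical T ↔ ∀ M : Ideal T, M.IsMaximal → x ∈ M := by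
  rw [IsArtinianRing.nilradical_eq_iInf, Ideal.mem_iInf]
  exact ⟨fun h M hM => h ⟨M, hM⟩, fun h M => h M.1 M.2⟩

theorem galoisTestSubgroup_eq_of_quotient_eq {n : ℕ} (hn : (n : T) ∈ nilradical T)
    {M : Ideal T} (htrans : ∀ M' : Ideal T, M'.IsMaximal → ∃ i : ℕ, ∀ x, x ∈ M' ↔ σ^[i] x ∈ M)
    {y z : Tˣ} (hy : y ∈ galoisTestSubgroup σ n) (hz : z ∈ galoisTestSubgroup σ n)
    (hyz : Ideal.Quotient.mk M (y : T) = Ideal.Quotient.mk M (z : T)) : y = z := by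
  have hJ : (y : T) - z ∈ nilradical T := by
    rw [mem_nilradical_iff_forall_isMaximal]
    intro M' hM'
    obtain ⟨i, hi⟩ := htrans M' hM'
    rw [hi, iterate_map_sub, iterate_of_mem_galoisTestSubgroup hy,
      iterate_of_mem_galoisTestSubgroup hz, ← Ideal.Quotient.eq, map_pow, map_pow, hyz]
  obtain ⟨N, hN⟩ := IsArtinianRing.isNilpotent_nilradical (R := T)
  have h := sub_pow_pow_mem_ideal_pow hn hJ N
  rw [pow_succ, hN, zero_mul, Ideal.zero_eq_bot, Ideal.mem_bot, sub_eq_zero,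
    ← iterate_of_mem_galoisTestSubgroup hy, ← iterate_of_mem_galoisTestSubgroup hz] at h
  exact Units.ext (σ.injective.iterate N h)

theorem card_nilradical_mul_le_card_units :
    Nat.card (T ⧸ nilradical T)ˣ * Nat.card (nilradical T) ≤ Nat.card Tˣ := by
  have hunit (u : (T ⧸ nilradical T)ˣ) (z : nilradical T) :
      IsUnit (Quotient.out (u : T ⧸ nilradical T) + (z : T)) := by
    rw [← IsArtinianRing.isNilpotent_nilradical.isUnit_quotient_mk_iff, map_add,
      Ideal.Quotient.mk_out, Ideal.Quotient.eq_zero_iff_mem.2 z.2, add_zero]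
    exact u.isUnit
  rw [← Nat.card_prod]
  refine Nat.card_le_card_of_injective (fun w => (hunit w.1 w.2).unit) ?_
  rintro ⟨u, z⟩ ⟨u', z'⟩ h
  have h1 : Quotient.out (u : T ⧸ nilradical T) + (z : T) =
      Quotient.out (u' : T ⧸ nilradical T) + (z' : T) := congrArg Units.val h
  have h2 := congrArg (Ideal.Quotient.mk (nilradical T)) h1
  simp only [map_add, Ideal.Quotient.mk_out, Ideal.Quotient.eq_zero_iff_mem.2 z.2,
    Ideal.Quotient.eq_zero_iff_mem.2 z'.2, add_zero] at h2
  obtain rfl := Units.ext h2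
  exact Prod.ext rfl (Subtype.ext (add_left_cancel h1))

theorem mem_nilradical_of_pow_mul_eq {p v : ℕ} (hv0 : (p : T) ^ v = 0)
    (hv1 : (p : T) ^ (v - 1) ≠ 0) (htrans : ∀ M M' : Ideal T, M.IsMaximal → M'.IsMaximal →
      ∃ i : ℕ, ∀ x, x ∈ M' ↔ σ^[i] x ∈ M)
    {j : ℕ} (hj : j < v) {x y : T} (hxy : (p : T) ^ j * x = (p : T) ^ (j + 1) * y) :
    x ∈ nilradical T := by
  let I : Ideal T := 
    Submodule.comap (LinearMap.mulLeft T ((p : T) ^ j)) (Ideal.span {(p : T) ^ (j + 1)})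
  have hI (z : T) : z ∈ I ↔ (p : T) ^ (j + 1) ∣ (p : T) ^ j * z := by
    change (p : T) ^ j * z ∈ Ideal.span _ ↔ _
    rw [Ideal.mem_span_singleton]
  have hIσ (z : T) (hz : z ∈ I) (i : ℕ) : σ^[i] z ∈ I := by
    rw [hI] at hz ⊢
    obtain ⟨c, hc⟩ := hz
    refine ⟨σ^[i] c, ?_⟩
    have := congrArg σ^[i] hc
    have hp : σ^[i] (p : T) = p := Function.iterate_fixed (map_natCast σ p) i
    rwa [iterate_map_mul, iterate_map_mul, iterate_map_pow, iterate_map_pow, hp] at this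
  have hne : I ≠ ⊤ := by
    rw [Ideal.ne_top_iff_one, hI]
    rintro ⟨c, hc⟩
    apply hv1
    rw [mul_one] at hc
    rw [show v - 1 = (v - 1 - j) + j by omega, pow_add, hc, ← mul_assoc, ← pow_add,
      show v - 1 - j + (j + 1) = v by omega, hv0, zero_mul]
  obtain ⟨M, hM, hIM⟩ := Ideal.exists_le_maximal I hne
  rw [mem_nilradical_iff_forall_isMaximal]
  intro M' hM'
  obtain ⟨i, hi⟩ := htrans M M' hM hM'
  exact (hi x).2 (hIM (hIσ x ((hI x).2 ⟨y, hxy⟩) i))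

theorem pow_card_quotient_nilradical_le {p v : ℕ} (hv0 : (p : T) ^ v = 0)
    (hv1 : (p : T) ^ (v - 1) ≠ 0) (htrans : ∀ M M' : Ideal T, M.IsMaximal → M'.IsMaximal →
      ∃ i : ℕ, ∀ x, x ∈ M' ↔ σ^[i] x ∈ M) {j : ℕ} (hj : j ≤ v) :
    Nat.card (T ⧸ nilradical T) ^ j ≤ Nat.card (Ideal.span {(p : T) ^ (v - j)}) := by
  induction j with
  | zero => rw [pow_zero]; exact Nat.card_pos
  | succ j ih =>
    obtain ⟨l, rfl⟩ : ∃ l, v = l + (j + 1) := ⟨v - (j + 1), by omega⟩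
    have ih := ih (by omega)
    rw [show l + (j + 1) - j = l + 1 by omega] at ih
    rw [show l + (j + 1) - (j + 1) = l by omega, pow_succ]
    refine (Nat.mul_le_mul_right _ ih).trans ?_
    rw [← Nat.card_prod]
    have hmem (w : Ideal.span {(p : T) ^ (l + 1)} × (T ⧸ nilradical T)) :
        (w.1 : T) + (p : T) ^ l * Quotient.out w.2 ∈ Ideal.span {(p : T) ^ l} := by
      refine Ideal.add_mem _ ?_ (Ideal.mul_mem_right _ _ (Ideal.mem_span_singleton_self _))
      exact Ideal.span_singleton_le_span_singleton.2 (pow_dvd_pow _ l.le_succ) w.1.2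
    refine Nat.card_le_card_of_injective
      (fun w => (⟨_, hmem w⟩ : Ideal.span {(p : T) ^ l})) ?_
    rintro ⟨a, c⟩ ⟨a', c'⟩ h
    have h1 : (a : T) + (p : T) ^ l * Quotient.out c = (a' : T) + (p : T) ^ l * Quotient.out c' :=
      congrArg Subtype.val h
    obtain ⟨b, hb⟩ := Ideal.mem_span_singleton.1 (Ideal.sub_mem _ a'.2 a.2)
    have h2 : (p : T) ^ l * (Quotient.out c - Quotient.out c') = (p : T) ^ (l + 1) * b := by
      rw [← hb]; linear_combination h1
    have h3 := mem_nilradical_of_pow_mul_eq σ hv0 hv1 htrans (by omega) h2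
    rw [← Ideal.Quotient.eq, Ideal.Quotient.mk_out, Ideal.Quotient.mk_out] at h3
    subst h3
    exact Prod.ext (Subtype.ext (add_right_cancel h1)) rfl

theorem pow_card_quotient_nilradical_le_card_nilradical {p v : ℕ} (hv : 0 < v)
    (hv0 : (p : T) ^ v = 0)
    (hv1 : (p : T) ^ (v - 1) ≠ 0) (htrans : ∀ M M' : Ideal T, M.IsMaximal → M'.IsMaximal →
      ∃ i : ℕ, ∀ x, x ∈ M' ↔ σ^[i] x ∈ M) :
    Nat.card (T ⧸ nilradical T) ^ (v - 1) ≤ Nat.card (nilradical T) := by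
  have hJ : Ideal.span {(p : T) ^ (v - (v - 1))} ≤ nilradical T := by
    rw [Ideal.span_singleton_le_iff_mem, show v - (v - 1) = 1 by omega, pow_one]
    exact ⟨v, hv0⟩
  exact (pow_card_quotient_nilradical_le σ hv0 hv1 htrans (Nat.sub_le v 1)).trans
    (Nat.card_le_card_of_injective _ (Submodule.inclusion_injective hJ))

theorem exists_iterate_mem_iff_of_isMaximal {M : Ideal T} (hM : M.IsMaximal) :
    ∃ i, 0 < i ∧ i ≤ Nat.card (MaximalSpectrum T) ∧ ∀ x, x ∈ M ↔ σ^[i] x ∈ M := by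
  have hmax (i : ℕ) : (M.comap ((σ : RingAut T) ^ i : T ≃+* T)).IsMaximal :=
    Ideal.comap_isMaximal_of_equiv _
  let F : Fin (Nat.card (MaximalSpectrum T) + 1) → MaximalSpectrum T := fun i => ⟨_, hmax i⟩
  have hF : ¬ Function.Injective F := fun h => by
    have := Nat.card_le_card_of_injective F h
    simp at this
  simp only [Function.Injective, not_forall] at hF
  obtain ⟨a, b, hab, hne⟩ := hF
  have key (a b : Fin (Nat.card (MaximalSpectrum T) + 1)) (hab : F a = F b) (hlt : a < b) :
      ∃ i, 0 < i ∧ i ≤ Nat.card (MaximalSpectrum T) ∧ ∀ x, x ∈ M ↔ σ^[i] x ∈ M := by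
    refine ⟨b - a, Nat.sub_pos_of_lt hlt, by omega, fun x => ?_⟩
    have hx (y : T) : σ^[a] y ∈ M ↔ σ^[b] y ∈ M := by
      have : y ∈ (F a).asIdeal ↔ y ∈ (F b).asIdeal := by rw [hab]
      simpa only [F, Ideal.mem_comap, coe_ringEquiv_pow] using this
    obtain ⟨y, rfl⟩ := σ.surjective.iterate a x
    rw [hx, ← Function.iterate_add_apply, Nat.sub_add_cancel (show (a : ℕ) ≤ b from hlt.le)]
  rcases lt_or_gt_of_ne hne with h | h
  · exact key a b hab h
  · exact key b a hab.symm h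

/-- Sizes of the unit group and of the group of solutions of `σ y = y ^ n` in a finite ring of
characteristic `p ^ v` whose maximal ideals form one `σ`-orbit with trivial inertia. -/
theorem exists_card_galoisTestSubgroup_bounds {p v n d : ℕ} (hp : p.Prime) (hv : 0 < v)
    (hpn : p ∣ n) (hn : 1 < n) (hnpp : ¬ IsPrimePow n)
    (hv0 : (p : T) ^ v = 0) (hv1 : (p : T) ^ (v - 1) ≠ 0)
    (htrans : ∀ M M' : Ideal T, M.IsMaximal → M'.IsMaximal →
      ∃ i : ℕ, ∀ x, x ∈ M' ↔ σ^[i] x ∈ M)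
    (hunram : ∀ M : Ideal T, M.IsMaximal → ∀ i : ℕ, 0 < i → i < d → ∃ x : T, σ^[i] x - x ∉ M) :
    ∃ f g : ℕ, 0 < f ∧ 0 < g ∧ d ≤ f * g ∧
      (p ^ f - 1) ^ g * p ^ (f * g * (v - 1)) ≤ Nat.card Tˣ ∧
      Nat.card (galoisTestSubgroup σ n) ≤ p ^ f - 1 ∧
      (g = 1 → Nat.card (galoisTestSubgroup σ n) ≤ n * p ^ (f / 2)) := by
  have : Nontrivial T := ⟨⟨_, _, hv1⟩⟩
  obtain ⟨M, hM⟩ := Ideal.exists_maximal T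
  let : Field (T ⧸ M) := Ideal.Quotient.field M
  have hpM : (p : T) ∈ M := hM.isPrime.mem_of_pow_mem v (by rw [hv0]; exact M.zero_mem)
  have : CharP (T ⧸ M) p := charP_of_prime_cast_eq_zero hp (by
    rw [← map_natCast (Ideal.Quotient.mk M), Ideal.Quotient.eq_zero_iff_mem]; exact hpM)
  have hnil : (n : T) ∈ nilradical T := by
    obtain ⟨c, rfl⟩ := hpn
    rw [Nat.cast_mul]
    exact Ideal.mul_mem_right _ _ ⟨v, hv0⟩
  have : Finite (T ⧸ M) := Quotient.finite _
  cases nonempty_fintype (T ⧸ M)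
  obtain ⟨⟨f, hf⟩, -, hcard⟩ := FiniteField.card (T ⧸ M) p
  rw [← Nat.card_eq_fintype_card, PNat.mk_coe] at hcard
  have hcard' (M' : MaximalSpectrum T) : Nat.card (T ⧸ M'.asIdeal) = p ^ f := by
    obtain ⟨i, hi⟩ := htrans M M'.1 hM M'.2
    rw [← hcard]
    obtain ⟨τ, -⟩ := exists_ringEquiv_quotient_apply ((σ : RingAut T) ^ i)
      (by simpa [coe_ringEquiv_pow] using hi)
    exact Nat.card_congr τ.toEquiv
  have hunits (M' : MaximalSpectrum T) : Nat.card (T ⧸ M'.asIdeal)ˣ = p ^ f - 1 := by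
    let : Field (T ⧸ M'.asIdeal) := Ideal.Quotient.field M'.asIdeal
    rw [Nat.card_units, hcard']
  cases nonempty_fintype (MaximalSpectrum T)
  set g := Nat.card (MaximalSpectrum T) with hg
  have hcardJ : Nat.card (T ⧸ nilradical T) = p ^ (f * g) := by
    rw [Nat.card_congr (IsArtinianRing.quotNilradicalEquivPi T).toEquiv, Nat.card_pi]
    simp [hcard', pow_mul, hg]
  have hunitsJ : Nat.card (T ⧸ nilradical T)ˣ = (p ^ f - 1) ^ g := by
    rw [Nat.card_congr (Units.mapEquiv
      (IsArtinianRing.quotNilradicalEquivPi T).toRingEquiv.toMulEquiv).toEquiv,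
      Nat.card_congr (MulEquiv.piUnits).toEquiv, Nat.card_pi]
    simp [hunits, hg]
  have hinj := fun y z => galoisTestSubgroup_eq_of_quotient_eq σ hnil
    (M := M) (fun M' hM' => htrans M M' hM hM') (y := y) (z := z)
  have hgpos : 0 < g := Nat.card_pos_iff.2 ⟨⟨⟨M, hM⟩⟩, inferInstance⟩
  refine ⟨f, g, hf, hgpos, ?_, ?_, ?_, ?_⟩
  · obtain ⟨i, hi0, hig, hi⟩ := exists_iterate_mem_iff_of_isMaximal σ hM
    refine le_trans ?_ (Nat.mul_le_mul_left f hig)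
    by_contra! hlt
    obtain ⟨x, hx⟩ := hunram M hM (f * i) (Nat.mul_pos hf hi0) hlt
    apply hx
    obtain ⟨τ, hτ⟩ := exists_ringEquiv_quotient_apply ((σ : RingAut T) ^ i)
      (by simpa [coe_ringEquiv_pow] using hi)
    obtain ⟨a, -, ha⟩ := FiniteField.exists_ringEquiv_eq_pow hp hcard τ
    have hpow (l : ℕ) : Ideal.Quotient.mk M (σ^[l * i] x) =
        Ideal.Quotient.mk M x ^ (p ^ a) ^ l := by
      induction l with
      | zero => simp
      | succ l ih =>
        rw [Nat.succ_mul, add_comm, Function.iterate_add_apply, ← coe_ringEquiv_pow σ i, ← hτ, ih,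
          ha, ← pow_mul, ← pow_succ]
    rw [← Ideal.Quotient.eq, hpow, ← pow_mul, mul_comm a f, pow_mul, ← hcard,
      Nat.card_eq_fintype_card, FiniteField.pow_card_pow]
  · rw [pow_mul, ← hcardJ, ← hunitsJ]
    exact (Nat.mul_le_mul_left _ (pow_card_quotient_nilradical_le_card_nilradical σ hv hv0 hv1
      htrans)).trans card_nilradical_mul_le_card_units
  · rw [← hunits ⟨M, hM⟩]
    refine Nat.card_le_card_of_injective
      (fun y => Units.map (Ideal.Quotient.mk M : T →* T ⧸ M) y.1) fun y z h => ?_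
    exact Subtype.ext (hinj _ _ y.2 z.2 (congrArg Units.val h))
  · intro hg1
    obtain ⟨i, hi0, hig, hi⟩ := exists_iterate_mem_iff_of_isMaximal σ hM
    obtain rfl : i = 1 := by omega
    obtain ⟨τ, hτ⟩ := exists_ringEquiv_quotient_apply σ hi
    refine le_trans ?_ (FiniteField.card_ringEquiv_eq_pow_le hp hcard τ hn hnpp)
    refine Nat.card_le_card_of_injective
      (fun y => ⟨Ideal.Quotient.mk M y.1, by
        rw [hτ, mem_galoisTestSubgroup.1 y.2, map_pow]⟩) fun y z h => ?_
    exact Subtype.ext (hinj _ _ y.2 z.2 (congrArg Subtype.val h))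

end

theorem card_pow_eq_one_or_neg_one_mul_le {ι : Type*} [Finite ι] {R : ι → Type*}
    [∀ i, CommRing (R i)] [∀ i, Finite (R i)] (hneg : ∀ i, (-1 : (R i)ˣ) ≠ 1) (i₀ : ι) {M : ℕ}
    {z : ∀ i, (R i)ˣ} (hz : z ^ M = -1) :
    Nat.card {x : ∀ i, (R i)ˣ // x ^ M = 1 ∨ x ^ M = -1} * 2 ^ (Nat.card ι - 1) ≤
      Nat.card (∀ i, (R i)ˣ) := by
  classical
  cases nonempty_fintype ι
  let y (s : {i // i ≠ i₀} → Bool) (i : ι) : (R i)ˣ :=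
    if h : i = i₀ then 1 else if s ⟨i, h⟩ then z i else 1
  have hy₀ (s) : y s i₀ = 1 := by simp [y]
  have hy (s) (i : {i // i ≠ i₀}) : y s i ^ M = if s i then -1 else 1 := by
    have hzi : z i ^ M = -1 := congrFun hz i
    simp only [y, dif_neg i.2, Subtype.coe_eta]
    split_ifs
    · exact hzi
    · exact one_pow M
  have hcard : Nat.card ({i // i ≠ i₀} → Bool) = 2 ^ (Nat.card ι - 1) := by
    simp [Nat.card_eq_fintype_card, Fintype.card_subtype_compl]
  rw [← hcard, ← Nat.card_prod]
  refine Nat.card_le_card_of_injective (fun w => w.1.1 * y w.2) ?_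
  rintro ⟨⟨x, hx⟩, s⟩ ⟨⟨x', hx'⟩, s'⟩ h
  have h : x * y s = x' * y s' := h
  have h₀ : x i₀ = x' i₀ := by simpa [hy₀] using congrFun h i₀
  have h₀M : (x ^ M) i₀ = (x' ^ M) i₀ := by simp only [Pi.pow_apply, h₀]
  have hxM : x ^ M = x' ^ M := by
    rcases hx with hx | hx <;> rcases hx' with hx' | hx' <;> rw [hx, hx'] at h₀M ⊢
    · exact absurd h₀M.symm (hneg i₀)
    · exact absurd h₀M (hneg i₀)
  have hs : s = s' := by
    funext i
    have h1 : (x * y s) ^ M = (x' * y s') ^ M := by rw [h]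
    rw [mul_pow, mul_pow, hxM] at h1
    have h2 : y s i ^ M = y s' i ^ M := congrFun (mul_left_cancel h1) i
    rw [hy, hy] at h2
    have := hneg i
    cases hsi : s i <;> cases hsi' : s' i <;> rw [hsi, hsi'] at h2
    · exact absurd h2.symm this
    · exact absurd h2 this
  subst hs
  exact Prod.ext (Subtype.ext (mul_right_cancel h)) rfl

theorem card_mrNonwitness_mul_le {n m k : ℕ} (hn : n ≠ 0) (hodd : Odd n) (hn1 : n ≠ 1)
    (hm : Odd m) :
    Nat.card {x : (ZMod n)ˣ // MRNonwitness n m k x} * 2 ^ (n.primeFactors.card - 1) ≤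
      Nat.card (ZMod n)ˣ := by
  classical
  have : NeZero n := ⟨hn⟩
  let P : ℕ → Prop := fun i => ∃ x : (ZMod n)ˣ, x ^ (m * 2 ^ i) = -1
  have hP0 : P 0 := ⟨-1, by simpa using hm.neg_one_pow⟩
  set t := Nat.findGreatest P k
  obtain ⟨z, hz⟩ : P t := Nat.findGreatest_spec (Nat.zero_le k) hP0
  have hsub (x : (ZMod n)ˣ) (hx : MRNonwitness n m k x) :
      x ^ (m * 2 ^ t) = 1 ∨ x ^ (m * 2 ^ t) = -1 := by
    rcases hx with hx | ⟨i, hik, hx⟩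
    · exact .inl (by rw [pow_mul, hx, one_pow])
    · have hit : i ≤ t := Nat.le_findGreatest hik.le ⟨x, hx⟩
      obtain ⟨c, hc⟩ := Nat.exists_eq_add_of_le hit
      rw [hc, pow_add, ← mul_assoc, pow_mul, hx]
      exact neg_one_pow_eq_or _ _
  obtain ⟨q, hq⟩ := Nat.nonempty_primeFactors.2
    (show 1 < n by omega)
  let e : (ZMod n)ˣ ≃* ∀ p : n.primeFactors, (ZMod (p ^ n.factorization p))ˣ :=
    (Units.mapEquiv (ZMod.equivPi n hn).toMulEquiv).trans MulEquiv.piUnits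
  have he : e (-1) = -1 := by
    funext p
    apply Units.ext
    change (ZMod.equivPi n hn) (-1) p = -1
    rw [map_neg, map_one]; rfl
  have (p : n.primeFactors) : NeZero ((p : ℕ) ^ n.factorization p) :=
    ⟨pow_ne_zero _ (Nat.prime_of_mem_primeFactors p.2).ne_zero⟩
  have hneg (p : n.primeFactors) : (-1 : (ZMod ((p : ℕ) ^ n.factorization p))ˣ) ≠ 1 := by
    have hp := Nat.prime_of_mem_primeFactors p.2
    have hpn := Nat.dvd_of_mem_primeFactors p.2
    have hv : n.factorization p ≠ 0 := (hp.factorization_pos_of_dvd hn hpn).ne'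
    have hp2 : 2 < (p : ℕ) := lt_of_le_of_ne hp.two_le fun h => by
      have := hodd.of_dvd_nat hpn
      rw [← h] at this
      exact absurd this (by decide)
    have : Fact (2 < (p : ℕ) ^ n.factorization p) :=
      ⟨hp2.trans_le (Nat.le_self_pow hv _)⟩
    intro h
    exact ZMod.neg_one_ne_one (congrArg Units.val h)
  have key := card_pow_eq_one_or_neg_one_mul_le hneg ⟨q, hq⟩ (z := e z) (M := m * 2 ^ t)
    (by rw [← map_pow, hz, he])
  rw [Nat.card_congr e.toEquiv]
  refine le_trans ?_ key
  rw [Nat.card_eq_fintype_card (α := n.primeFactors), Fintype.card_coe]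
  refine Nat.mul_le_mul_right _ (Nat.card_le_card_of_injective
    (Subtype.map e fun x hx => ?_) (Subtype.map_injective _ e.injective))
  rw [← map_pow]
  rcases hsub x hx with h | h
  · exact .inl (by rw [h, map_one])
  · exact .inr (by rw [h, he])

/-- Reduction to the `p`-primary quotient is surjective on units. -/
theorem units_map_quotient_span_surjective {S : Type*} [CommRing S] {a b : ℕ}
    (hab : a.Coprime b) (h0 : ((a * b : ℕ) : S) = 0) :
    Function.Surjective
      (Units.map (Ideal.Quotient.mk (Ideal.span {(a : S)}) : S →* S ⧸ Ideal.span {(a : S)})) := by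
  intro u
  obtain ⟨s, hs⟩ := Ideal.Quotient.mk_surjective (u : S ⧸ Ideal.span {(a : S)})
  obtain ⟨t, ht⟩ := Ideal.Quotient.mk_surjective u⁻¹.val
  obtain ⟨α, β, hαβ⟩ := Nat.isCoprime_iff_coprime.2 hab
  have hbez : (α : S) * a + β * b = 1 := by exact_mod_cast congrArg (Int.cast : ℤ → S) hαβ
  rw [Nat.cast_mul] at h0
  have hst : s * t - 1 ∈ Ideal.span {(a : S)} := by
    rw [← Ideal.Quotient.eq, map_mul, hs, ht, map_one, Units.mul_inv]
  obtain ⟨c, hc⟩ := Ideal.mem_span_singleton.1 hst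
  have hmul : (s * (β * b) + α * a) * (t * (β * b) + α * a) = 1 := by
    linear_combination (β * b) ^ 2 * hc + (c * β * β * b + (s + t) * β * α - 2 * α * β) * h0 +
      (α * a + β * b + 1) * hbez
  refine ⟨Units.mkOfMulEqOne _ _ hmul, Units.ext ?_⟩
  rw [Units.coe_map, Units.val_mkOfMulEqOne, ← hs]
  change Ideal.Quotient.mk _ _ = _
  rw [Ideal.Quotient.eq, Ideal.mem_span_singleton]
  exact ⟨α * (1 - s), by linear_combination s * hbez⟩

theorem card_galoisTestSubgroup_mul_le {S T : Type*} [CommRing S] [CommRing T] [Finite S]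
    (σ : S ≃+* S) (τ : T ≃+* T) (φ : S →+* T) (hφ : ∀ x, φ (σ x) = τ (φ x))
    (hsurj : Function.Surjective (Units.map (φ : S →* T))) (n : ℕ) :
    Nat.card (galoisTestSubgroup σ n) * Nat.card Tˣ ≤
      Nat.card (galoisTestSubgroup τ n) * Nat.card Sˣ := by
  have hle : galoisTestSubgroup σ n ≤
      (galoisTestSubgroup τ n).comap (Units.map (φ : S →* T)) := by
    intro y hy
    rw [Subgroup.mem_comap, mem_galoisTestSubgroup]
    rw [mem_galoisTestSubgroup] at hy
    simp only [Units.coe_map, MonoidHom.coe_coe]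
    rw [← hφ, hy, map_pow]
  have hidx := Subgroup.index_comap_of_surjective (galoisTestSubgroup τ n) hsurj
  rw [← Subgroup.card_mul_index (galoisTestSubgroup τ n),
    ← Subgroup.card_mul_index ((galoisTestSubgroup τ n).comap (Units.map (φ : S →* T))), hidx]
  calc _ ≤ _ := Nat.mul_le_mul_right _ (Subgroup.card_le_of_le hle)
    _ = _ := by ring

/-- The maximal ideals above `p` are permuted transitively by `σ`. -/
theorem exists_iterate_mem_iff_of_prime_mem {n d p : ℕ} (hp : p.Prime) (hpn : p ∣ n) (hd : 0 < d)
    {S : Type*} [CommRing S] [Algebra (ZMod n) S] (σ : S ≃ₐ[ZMod n] S) (hord : orderOf σ = d)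
    (hfix : ∀ x : S, σ x = x ↔ x ∈ Set.range (algebraMap (ZMod n) S))
    (M M' : Ideal S) (hM : M.IsMaximal) (hM' : M'.IsMaximal) (hpM : (p : S) ∈ M)
    (hpM' : (p : S) ∈ M') : ∃ i : ℕ, ∀ x, x ∈ M' ↔ σ^[i] x ∈ M := by
  let G := Subgroup.zpowers σ
  have hfin : IsOfFinOrder σ := orderOf_pos_iff.1 (hord ▸ hd)
  have : Finite G := by
    rw [← Nat.card_zpowers] at hord
    exact Nat.finite_of_card_ne_zero (by rw [hord]; exact hd.ne')
  have : Algebra.IsInvariant (ZMod n) S G :=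
    ⟨fun b hb => (hfix b).1 (hb ⟨σ, Subgroup.mem_zpowers σ⟩)⟩
  have hunder (Q : Ideal S) (hQ : Q.IsMaximal) (hpQ : (p : S) ∈ Q) :
      Q.under (ZMod n) = Ideal.span {(p : ZMod n)} := by
    have hmax : (Ideal.span {(p : ZMod n)}).IsMaximal := by
      have hker : RingHom.ker (ZMod.castHom hpn (ZMod p)) = Ideal.span {(p : ZMod n)} := by
        ext x
        obtain ⟨c, rfl⟩ := ZMod.intCast_surjective x
        rw [RingHom.mem_ker, map_intCast, ZMod.intCast_zmod_eq_zero_iff_dvd,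
          Ideal.mem_span_singleton]
        refine ⟨fun ⟨b, hb⟩ => ⟨b, by rw [hb]; push_cast; rfl⟩, fun ⟨b, hb⟩ => ?_⟩
        have := congrArg (ZMod.castHom hpn (ZMod p)) hb
        rw [map_mul, map_natCast, map_intCast, ZMod.natCast_self, zero_mul] at this
        exact (ZMod.intCast_zmod_eq_zero_iff_dvd _ _).1 this
      have : Fact p.Prime := ⟨hp⟩
      rw [← hker]
      exact RingHom.ker_isMaximal_of_surjective _ (ZMod.castHom_surjective hpn)
    have := hQ.isPrime
    refine (hmax.eq_of_le (Ideal.IsPrime.ne_top inferInstance) ?_).symm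
    rw [Ideal.span_singleton_le_iff_mem, Ideal.mem_comap, map_natCast]
    exact hpQ
  have := hM.isPrime
  have := hM'.isPrime
  obtain ⟨⟨γ, hγ⟩, hQ⟩ := Algebra.IsInvariant.exists_smul_of_under_eq (ZMod n) S G M' M
    ((hunder M' hM' hpM').trans (hunder M hM hpM).symm)
  rw [← hfin.mem_powers_iff_mem_zpowers] at hγ
  obtain ⟨i, rfl⟩ := hγ
  refine ⟨i, fun x => ?_⟩
  rw [hQ, ← AlgEquiv.coe_pow]
  exact (Ideal.smul_mem_pointwise_smul_iff (a := (⟨σ ^ i, hγ⟩ : G))).symm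

theorem exists_card_galoisTestSubgroup_bounds_of_prime_dvd {n d p : ℕ} (hn : 1 < n)
    (hnpp : ¬ IsPrimePow n) (hp : p.Prime) (hpn : p ∣ n) (hd : 0 < d)
    {S : Type*} [CommRing S] [Finite S] [Algebra (ZMod n) S]
    (hfaithful : Function.Injective (algebraMap (ZMod n) S))
    (σ : S ≃ₐ[ZMod n] S) (hord : orderOf σ = d)
    (hfix : ∀ x : S, σ x = x ↔ x ∈ Set.range (algebraMap (ZMod n) S))
    (hunram : ∀ M : Ideal S, M.IsMaximal → ∀ i : ℕ, 0 < i → i < d →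
      ∃ x : S, (σ ^ i) x - x ∉ M) :
    ∃ f g h U : ℕ, 0 < f ∧ 0 < g ∧ d ≤ f * g ∧ 0 < h ∧
      (p ^ f - 1) ^ g * p ^ (f * g * (n.factorization p - 1)) ≤ U ∧
      h ≤ p ^ f - 1 ∧ (g = 1 → h ≤ n * p ^ (f / 2)) ∧
      Nat.card (galoisTestSubgroup (σ : S ≃+* S) n) * U ≤ h * Nat.card Sˣ := by
  have hn0 : n ≠ 0 := by omega
  set v := n.factorization p
  have hv : 0 < v := hp.factorization_pos_of_dvd hn0 hpn
  obtain ⟨b, hb⟩ : p ^ v ∣ n := Nat.ordProj_dvd n p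
  have hnS : (n : S) = 0 := by
    rw [← map_natCast (algebraMap (ZMod n) S), ZMod.natCast_self, map_zero]
  have hcop : (p ^ v).Coprime b := by
    have := (Nat.coprime_ordCompl hp hn0).pow_left v
    rwa [show n / p ^ n.factorization p = b from
      Nat.div_eq_of_eq_mul_right (Nat.pow_pos hp.pos) hb] at this
  have hbpos : 0 < b := Nat.pos_of_ne_zero (by rintro rfl; simp at hb; omega)
  set I := Ideal.span {((p ^ v : ℕ) : S)} with hI
  have hσn (c : ℕ) : σ (c : S) = c := map_natCast σ c
  have hIσ (x : S) : x ∈ I ↔ (σ : S ≃+* S) x ∈ I := by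
    simp only [hI, Ideal.mem_span_singleton]
    constructor
    · rintro ⟨c, rfl⟩
      exact ⟨σ c, by rw [map_mul, map_natCast]; rfl⟩
    · rintro ⟨c, hc⟩
      refine ⟨σ.symm c, σ.injective ?_⟩
      rw [map_mul, hσn, AlgEquiv.apply_symm_apply]
      exact hc
  obtain ⟨τ, hτ⟩ := exists_ringEquiv_quotient_apply (σ : S ≃+* S) hIσ
  have : Finite (S ⧸ I) := Quotient.finite _
  have hτi (i : ℕ) (x : S) :
      τ^[i] (Ideal.Quotient.mk I x) = Ideal.Quotient.mk I (σ^[i] x) := by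
    induction i with
    | zero => rfl
    | succ i ih =>
      rw [Function.iterate_succ_apply', ih, hτ, Function.iterate_succ_apply']; rfl
  have hcomap (M : Ideal (S ⧸ I)) (hM : M.IsMaximal) :
      (M.comap (Ideal.Quotient.mk I)).IsMaximal :=
    Ideal.comap_isMaximal_of_surjective _ Ideal.Quotient.mk_surjective
  have hv0 : (p : S ⧸ I) ^ v = 0 := by
    rw [← Nat.cast_pow, ← map_natCast (Ideal.Quotient.mk I), Ideal.Quotient.eq_zero_iff_mem]
    exact Ideal.mem_span_singleton_self _
  have hv1 : (p : S ⧸ I) ^ (v - 1) ≠ 0 := by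
    rw [← Nat.cast_pow, ← map_natCast (Ideal.Quotient.mk I), Ne, Ideal.Quotient.eq_zero_iff_mem,
      Ideal.mem_span_singleton]
    rintro ⟨c, hc⟩
    have h0 : ((p ^ (v - 1) * b : ℕ) : S) = 0 := by
      have : (((p ^ v) * b : ℕ) : S) = 0 := by rw [← hb, hnS]
      push_cast at this hc ⊢
      rw [hc]
      linear_combination c * this
    rw [← map_natCast (algebraMap (ZMod n) S), map_eq_zero_iff _ hfaithful,
      ZMod.natCast_eq_zero_iff] at h0
    have hle := Nat.le_of_dvd (Nat.mul_pos (Nat.pow_pos hp.pos) hbpos) h0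
    rw [hb] at hle
    exact absurd (Nat.le_of_mul_le_mul_right hle hbpos)
      (not_le.2 (Nat.pow_lt_pow_right hp.one_lt (by omega)))
  have hpmem (M : Ideal (S ⧸ I)) (hM : M.IsMaximal) :
      (p : S) ∈ M.comap (Ideal.Quotient.mk I) := by
    rw [Ideal.mem_comap, map_natCast]
    exact hM.isPrime.mem_of_pow_mem v (by rw [hv0]; exact M.zero_mem)
  have htrans (M M' : Ideal (S ⧸ I)) (hM : M.IsMaximal) (hM' : M'.IsMaximal) :
      ∃ i : ℕ, ∀ x, x ∈ M' ↔ τ^[i] x ∈ M := by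
    obtain ⟨i, hi⟩ := exists_iterate_mem_iff_of_prime_mem hp hpn hd σ hord hfix _ _
      (hcomap M hM) (hcomap M' hM') (hpmem M hM) (hpmem M' hM')
    refine ⟨i, fun y => ?_⟩
    obtain ⟨x, rfl⟩ := Ideal.Quotient.mk_surjective y
    rw [hτi]
    exact hi x
  obtain ⟨f, g, hf, hg, hdfg, hU, hH, hH1⟩ := exists_card_galoisTestSubgroup_bounds τ hp hv hpn hn
    hnpp hv0 hv1 htrans (d := d) fun M hM i hi hid => by
      obtain ⟨x, hx⟩ := hunram _ (hcomap M hM) i hi hid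
      refine ⟨Ideal.Quotient.mk I x, ?_⟩
      rw [hτi, ← map_sub, ← AlgEquiv.coe_pow]
      exact hx
  exact ⟨f, g, _, _, hf, hg, hdfg, Nat.card_pos, hU, hH, hH1,
    card_galoisTestSubgroup_mul_le (σ : S ≃+* S) τ (Ideal.Quotient.mk I) (fun x => (hτ x).symm)
      (units_map_quotient_span_surjective hcop (by rw [← hb, hnS])) n⟩

theorem sub_mul_log_le_log_pow_sub_one {B : ℝ} (hB : 0 < B) {p f : ℕ} (hp : 4 < p)
    (hBp : B ≤ p) (hf : 0 < f) :
    ((f : ℝ) - 2 / B) * Real.log p ≤ Real.log ((p : ℝ) ^ f - 1) := by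
  have hp4 : (4 : ℝ) < p := by exact_mod_cast hp
  have hlog : 1 ≤ Real.log p := by
    rw [Real.le_log_iff_exp_le (by linarith)]
    linarith [Real.exp_one_lt_d9]
  have hpf : (p : ℝ) ≤ (p : ℝ) ^ f := le_self_pow₀ (by linarith) hf.ne'
  have h1 : (p : ℝ) ^ f * (1 - 1 / p) ≤ (p : ℝ) ^ f - 1 := by
    have : 1 ≤ (p : ℝ) ^ f * (1 / p) := by
      rw [mul_one_div, one_le_div (by linarith)]; exact hpf
    linarith
  have hpos : (0 : ℝ) < 1 - 1 / p := by
    rw [sub_pos, div_lt_one (by linarith)]; linarith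
  have h2 : 1 - (1 - 1 / (p : ℝ))⁻¹ ≤ Real.log (1 - 1 / p) := Real.one_sub_inv_le_log_of_pos hpos
  have h3 : -(2 / (p : ℝ)) ≤ 1 - (1 - 1 / (p : ℝ))⁻¹ := by
    have : (1 - 1 / (p : ℝ))⁻¹ = 1 + 1 / (p - 1) := by
      have : (p : ℝ) - 1 ≠ 0 := by linarith
      field_simp
      ring
    rw [this]
    have : 1 / ((p : ℝ) - 1) ≤ 2 / p := by
      rw [div_le_div_iff₀ (by linarith) (by linarith)]; linarith
    linarith
  have h4 : 2 / (p : ℝ) ≤ 2 / B * Real.log p :=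
    (div_le_div_of_nonneg_left (by norm_num) hB hBp).trans
      (le_mul_of_one_le_right (by positivity) hlog)
  have h5 := Real.log_le_log (by positivity) h1
  rw [Real.log_mul (by positivity) hpos.ne', Real.log_pow] at h5
  linarith

/-- The numerical comparison when the number of prime factors is small. -/
theorem div_le_two_rpow_of_card_bounds {A B C : ℝ} (hA : 2 < A) (hB : 4 * A / (A - 2) ≤ B)
    (hC : C = 1 - 2 / A - 4 / B) {n p v w r d f g h U : ℕ} (hp : 4 < p) (hBp : B ≤ p)
    (hn : 0 < n) (hv : 0 < v) (hnp : n ≤ (p ^ v) ^ w) (hwd : w * A ≤ d) (hd : 0 < d)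
    (hrd : (d : ℝ) * r * (1 - A / d) ≤ A ^ 2 * C * Real.log n / (2 * Real.log 2))
    (hf : 0 < f) (hg : 0 < g) (hdfg : d ≤ f * g) (hh : 0 < h)
    (hU : (p ^ f - 1) ^ g * p ^ (f * g * (v - 1)) ≤ U) (hH : h ≤ p ^ f - 1)
    (hH1 : g = 1 → h ≤ n * p ^ (f / 2)) :
    (h : ℝ) / U ≤ (2 : ℝ) ^ (-((r : ℝ) * d / A) * (1 - A / d)) := by
  have hB0 : 0 < B := lt_of_lt_of_le (by apply div_pos <;> linarith) hB
  have hp4 : (4 : ℝ) < p := by exact_mod_cast hp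
  have hlog2 : 0 < Real.log 2 := Real.log_pos one_lt_two
  have hC0 : 0 ≤ C := by
    rw [div_le_iff₀ (by linarith)] at hB
    have : 4 / B ≤ 1 - 2 / A := by
      rw [div_le_iff₀ hB0]
      have : (1 - 2 / A) * B = B * (A - 2) / A := by field_simp
      rw [this, le_div_iff₀ (by linarith)]; exact hB
    linarith
  have hpf1 : 1 < p ^ f := Nat.one_lt_pow hf.ne' (by omega)
  have hcast : ((p ^ f - 1 : ℕ) : ℝ) = (p : ℝ) ^ f - 1 := by
    rw [Nat.cast_sub hpf1.le]; simp
  have hpf : (0 : ℝ) < (p : ℝ) ^ f - 1 := by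
    rw [← hcast]; exact_mod_cast Nat.sub_pos_of_lt hpf1
  have hq := sub_mul_log_le_log_pow_sub_one hB0 hp hBp hf
  set ℓ := Real.log p
  set q := Real.log ((p : ℝ) ^ f - 1)
  have hℓ : 0 < ℓ := Real.log_pos (by linarith)
  have hlogU : g * q + f * g * (v - 1) * ℓ ≤ Real.log U := by
    have h1 : (((p ^ f - 1) ^ g * p ^ (f * g * (v - 1)) : ℕ) : ℝ) ≤ U := by exact_mod_cast hU
    have h2 := Real.log_le_log (by
      rw [Nat.cast_mul, Nat.cast_pow, hcast]; positivity) h1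
    rw [Nat.cast_mul, Nat.cast_pow, hcast, Nat.cast_pow,
      Real.log_mul (by positivity) (by positivity), Real.log_pow, Real.log_pow] at h2
    push_cast [Nat.cast_sub (show 1 ≤ v from hv)] at h2
    exact h2
  have hUpos : (0 : ℝ) < U := by
    have : 0 < (p ^ f - 1) ^ g * p ^ (f * g * (v - 1)) :=
      Nat.mul_pos (Nat.pow_pos (Nat.sub_pos_of_lt hpf1)) (Nat.pow_pos (by omega))
    exact_mod_cast this.trans_le hU
  have hhpos : (0 : ℝ) < h := by exact_mod_cast hh
  have hlogh : Real.log h ≤ q := by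
    apply Real.log_le_log hhpos
    rw [← hcast]; exact_mod_cast hH
  have hlogn : Real.log n ≤ w * (v * ℓ) := by
    have h1 : (n : ℝ) ≤ ((p : ℝ) ^ v) ^ w := by exact_mod_cast hnp
    have h2 := Real.log_le_log (by exact_mod_cast hn) h1
    rwa [Real.log_pow, Real.log_pow] at h2
  have hlogn0 : 0 ≤ Real.log n := Real.log_natCast_nonneg n
  have hA0 : 0 < A := by linarith
  have hAlogn : A * Real.log n ≤ d * (v * ℓ) := by
    calc A * Real.log n ≤ A * (w * (v * ℓ)) := by gcongr
      _ = (w * A) * (v * ℓ) := by ring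
      _ ≤ _ := by gcongr
  have hd' : (1 : ℝ) ≤ d := by exact_mod_cast hd
  have hf' : (1 : ℝ) ≤ f := by exact_mod_cast hf
  have hg' : (1 : ℝ) ≤ g := by exact_mod_cast hg
  have hv' : (1 : ℝ) ≤ v := by exact_mod_cast hv
  have hdfg' : (d : ℝ) ≤ f * g := by exact_mod_cast hdfg
  have hA' : 0 < 1 / A := by positivity
  have hB' : 0 < 1 / B := by positivity
  have hC2 : C = 1 - 2 * (1 / A) - 4 * (1 / B) := by rw [hC]; ring
  have htarget : ((r : ℝ) * d / A) * (1 - A / d) * Real.log 2 ≤ C / 2 * (d * (v * ℓ)) := by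
    rw [le_div_iff₀ (by positivity)] at hrd
    have e : ((r : ℝ) * d / A) * (1 - A / d) * Real.log 2 =
      (d * r * (1 - A / d) * (2 * Real.log 2)) * (1 / (2 * A)) := by field_simp
    calc _ = _ := e
      _ ≤ (A ^ 2 * C * Real.log n) * (1 / (2 * A)) := by gcongr
      _ = C / 2 * (A * Real.log n) := by field_simp
      _ ≤ _ := by gcongr
  have hmain : C / 2 * (d * (v * ℓ)) ≤ Real.log U - Real.log h := by
    set b := 1 / B with hb
    set a := 1 / A with ha
    have hqb : (f - 2 * b) * ℓ ≤ q := by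
      rw [hb, mul_one_div]; exact hq
    by_cases hg1 : g = 1
    · have h1 : (h : ℝ) ≤ n * (p : ℝ) ^ (f / 2) := by exact_mod_cast hH1 hg1
      have hn' : (0 : ℝ) < n := by exact_mod_cast hn
      have h2 := Real.log_le_log hhpos h1
      rw [Real.log_mul hn'.ne' (by positivity), Real.log_pow] at h2
      have h3 : ((f / 2 : ℕ) : ℝ) ≤ f / 2 := Nat.cast_div_le
      have h4 : ((f / 2 : ℕ) : ℝ) * ℓ ≤ f / 2 * ℓ := by gcongr
      have h5 : Real.log n ≤ a * (d * (v * ℓ)) := by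
        rw [ha, one_div, ← div_eq_inv_mul, le_div_iff₀ hA0, mul_comm]; exact hAlogn
      rw [hg1, Nat.cast_one] at hlogU hdfg'
      have h6 : (d : ℝ) * v ≤ f * v := by
        rw [mul_one] at hdfg'; gcongr
      have h7 : b * 1 ≤ b * ((d : ℝ) * v) := by
        gcongr; exact one_le_mul_of_one_le_of_one_le hd' hv'
      have h8 : (f : ℝ) * 1 ≤ f * v := by gcongr
      have h9 : C / 2 * (d * v) ≤ f * v - 2 * b - a * (d * v) - f / 2 := by
        rw [hC2]; linarith
      have h10 := mul_le_mul_of_nonneg_right h9 hℓ.le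
      linarith
    · have hg2 : (2 : ℝ) ≤ g := by
        have : 2 ≤ g := by omega
        exact_mod_cast this
      have hC1 : C ≤ 1 - 4 * b := by linarith
      have h1 : C / 2 * (f * g) ≤ (g - 1) * (f - 2 * b) := by
        have : C / 2 * (f * g) ≤ (1 - 4 * b) / 2 * (f * g) := by gcongr
        have h2 : (f : ℝ) * 2 ≤ f * g := by gcongr
        have h3 : 1 * (g : ℝ) * b ≤ f * g * b := by gcongr
        linarith
      have h2 : C / 2 * (f * g * (v - 1)) ≤ f * g * (v - 1) := by
        have : 0 ≤ (f : ℝ) * g * (v - 1) := mul_nonneg (by positivity) (by linarith)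
        exact mul_le_of_le_one_left this (by linarith)
      have h3 : C / 2 * (d * v) ≤ (g - 1) * (f - 2 * b) + f * g * (v - 1) := by
        have : C / 2 * (d * v) ≤ C / 2 * (f * g * v) := by gcongr
        linarith
      have h4 := mul_le_mul_of_nonneg_right h3 hℓ.le
      have h5 := mul_le_mul_of_nonneg_left hqb (show (0 : ℝ) ≤ g - 1 by linarith)
      linarith
  rw [Real.rpow_def_of_pos two_pos, ← Real.log_le_iff_le_exp (by positivity),
    Real.log_div hhpos.ne' hUpos.ne']
  linarith

theorem card_badWitness_eq {n m k r : ℕ} {S : Type*} [CommRing S] [Algebra (ZMod n) S]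
    (σ : S ≃ₐ[ZMod n] S) :
    Nat.card {w : (Fin r → (ZMod n)ˣ) × Sˣ //
        (∀ i : Fin r, MRNonwitness n m k (w.1 i)) ∧ σ (w.2 : S) = (w.2 : S) ^ n} =
      Nat.card {x : (ZMod n)ˣ // MRNonwitness n m k x} ^ r *
        Nat.card (galoisTestSubgroup (σ : S ≃+* S) n) := by
  have e : {w : (Fin r → (ZMod n)ˣ) × Sˣ //
      (∀ i : Fin r, MRNonwitness n m k (w.1 i)) ∧ σ (w.2 : S) = (w.2 : S) ^ n} ≃
      (Fin r → {x : (ZMod n)ˣ // MRNonwitness n m k x}) ×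
        galoisTestSubgroup (σ : S ≃+* S) n :=
    { toFun := fun w => (fun i => ⟨w.1.1 i, w.2.1 i⟩, ⟨w.1.2, mem_galoisTestSubgroup.2 w.2.2⟩)
      invFun := fun w => ⟨(fun i => (w.1 i).1, w.2.1),
        fun i => (w.1 i).2, mem_galoisTestSubgroup.1 w.2.2⟩
      left_inv := fun _ => rfl
      right_inv := fun _ => rfl }
  rw [Nat.card_congr e, Nat.card_prod, Nat.card_fun, Nat.card_fin]

theorem exists_le_ordProj_pow_card_primeFactors {n : ℕ} (hn : 1 < n) :
    ∃ p, p.Prime ∧ p ∣ n ∧ n ≤ (p ^ n.factorization p) ^ n.primeFactors.card := by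
  obtain ⟨p, hp, hmax⟩ := Finset.exists_max_image n.primeFactors (fun p => p ^ n.factorization p)
    (Nat.nonempty_primeFactors.2 hn)
  refine ⟨p, Nat.prime_of_mem_primeFactors hp, Nat.dvd_of_mem_primeFactors hp, ?_⟩
  calc n = ∏ q ∈ n.primeFactors, q ^ n.factorization q :=
        (Nat.prod_factorization_pow_eq_self (by omega)).symm
    _ ≤ _ := Finset.prod_le_pow_card _ _ _ hmax

/-- **Density of the composed test.** Let `A > 2`, `B ≥ 4A/(A-2)`, `C = 1 - 2/A - 4/B`.
Let `n` be a positive integer, not a prime power, with no prime divisor smaller than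
`B`. Let `r, d` be positive integers with `d·r·(1 - A/d) ≤ A²·C·log n/(2·log 2)`, and
let `S` be a cyclic extension of `ℤ/nℤ` of dimension `d` with generator `σ`. Then the
density of bad witnesses for the product of `r` Miller–Rabin tests and one Galois test
of dimension `d` is at most `2^(-(r·d/A)·(1 - A/d))`. -/
theorem stmt_2 (A B C : ℝ) (hA : 2 < A) (hB : 4 * A / (A - 2) ≤ B)
    (hC : C = 1 - 2 / A - 4 / B)
    (n : ℕ) (hn : 0 < n) (hnpp : ¬ IsPrimePow n)
    (hprimes : ∀ q : ℕ, q.Prime → q ∣ n → B ≤ (q : ℝ))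
    (r d : ℕ) (hr : 0 < r) (hd : 0 < d)
    (hrd : (d : ℝ) * r * (1 - A / d) ≤ A ^ 2 * C * Real.log n / (2 * Real.log 2))
    (S : Type*) [CommRing S] [Fintype S] [Algebra (ZMod n) S]
    (hfaithful : Function.Injective (algebraMap (ZMod n) S))
    (σ : S ≃ₐ[ZMod n] S) (hord : orderOf σ = d)
    (hfix : ∀ x : S, σ x = x ↔ x ∈ Set.range (algebraMap (ZMod n) S))
    (hunram : ∀ M : Ideal S, M.IsMaximal → ∀ i : ℕ, 0 < i → i < d →
      ∃ x : S, (σ ^ i) x - x ∉ M)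
    (m k : ℕ) (hm : Odd m) (hmk : n - 1 = m * 2 ^ k) :
    (Nat.card {w : (Fin r → (ZMod n)ˣ) × Sˣ //
        (∀ i : Fin r, MRNonwitness n m k (w.1 i)) ∧ σ (w.2 : S) = (w.2 : S) ^ n} : ℝ) /
      ((Nat.card (ZMod n)ˣ : ℝ) ^ r * (Nat.card Sˣ : ℝ)) ≤
      (2 : ℝ) ^ (-((r : ℝ) * d / A) * (1 - A / d)) := by
  have hB4 : 4 < B := by
    refine lt_of_lt_of_le ?_ hB
    rw [lt_div_iff₀ (by linarith)]; linarith
  have hprime4 (q : ℕ) (hq : q.Prime) (hqn : q ∣ n) : 4 < q := by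
    exact_mod_cast hB4.trans_le (hprimes q hq hqn)
  have hodd : Odd n := by
    rw [← Nat.not_even_iff_odd]
    exact fun h => absurd (hprime4 2 Nat.prime_two h.two_dvd) (by norm_num)
  have hn1 : 1 < n := by
    by_contra! h
    have : m * 2 ^ k ≠ 0 := mul_ne_zero hm.pos.ne' (by positivity)
    omega
  have : NeZero n := ⟨hn.ne'⟩
  rw [card_badWitness_eq]
  set X := Nat.card {x : (ZMod n)ˣ // MRNonwitness n m k x}
  set H := Nat.card (galoisTestSubgroup (σ : S ≃+* S) n)
  set F := Nat.card (ZMod n)ˣ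
  set s := Nat.card Sˣ
  set w := n.primeFactors.card with hw
  have hF : (0 : ℝ) < F := by exact_mod_cast Nat.card_pos
  have hs : (0 : ℝ) < s := by exact_mod_cast Nat.card_pos
  have hXF : (X : ℝ) / F ≤ 1 := by
    rw [div_le_one hF]
    exact_mod_cast Nat.card_le_card_of_injective _ Subtype.val_injective
  have hHs : (H : ℝ) / s ≤ 1 := by
    rw [div_le_one hs]
    exact_mod_cast Subgroup.card_le_card_group _
  have hsplit : ((X ^ r * H : ℕ) : ℝ) / ((F : ℝ) ^ r * s) = ((X : ℝ) / F) ^ r * (H / s) := by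
    push_cast
    rw [div_pow, mul_div_mul_comm]
  rw [hsplit]
  have hA0 : 0 < A := by linarith
  have hd' : (0 : ℝ) < d := by exact_mod_cast hd
  rcases le_total (d : ℝ) (w * A) with hdw | hdw
  · have hw1 : 1 ≤ w := Finset.card_pos.2 (Nat.nonempty_primeFactors.2 hn1)
    have hMR : (X : ℝ) * 2 ^ (w - 1) ≤ F := by
      exact_mod_cast card_mrNonwitness_mul_le hn.ne' hodd hn1.ne' hm
    have hMR' : (X : ℝ) / F ≤ ((2 : ℝ) ^ (w - 1))⁻¹ := by
      rw [div_le_iff₀ hF, ← div_eq_inv_mul, le_div_iff₀ (by positivity)]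
      exact hMR
    calc ((X : ℝ) / F) ^ r * (H / s) ≤ ((X : ℝ) / F) ^ r :=
          mul_le_of_le_one_right (by positivity) hHs
      _ ≤ (((2 : ℝ) ^ (w - 1))⁻¹) ^ r := by gcongr
      _ = (2 : ℝ) ^ (-(((w : ℝ) - 1) * r)) := by
          rw [inv_pow, ← pow_mul, Real.rpow_neg two_pos.le, ← Real.rpow_natCast]
          push_cast [Nat.cast_sub hw1]
          rfl
      _ ≤ _ := by
          apply Real.rpow_le_rpow_of_exponent_le one_le_two
          have e : -((r : ℝ) * d / A) * (1 - A / d) = -((d / A - 1) * r) := by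
            field_simp
          rw [e]
          have : (d : ℝ) / A ≤ w := by rwa [div_le_iff₀ hA0]
          gcongr
  · obtain ⟨p, hp, hpn, hnp⟩ := exists_le_ordProj_pow_card_primeFactors hn1
    obtain ⟨f, g, h, U, hf, hg, hdfg, hh, hU, hH, hH1, hHU⟩ :=
      exists_card_galoisTestSubgroup_bounds_of_prime_dvd hn1 hnpp hp hpn hd hfaithful σ hord hfix
        hunram
    have hp4 := hprime4 p hp hpn
    have hUpos : (0 : ℝ) < U := by
      have : 0 < (p ^ f - 1) ^ g * p ^ (f * g * (n.factorization p - 1)) :=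
        Nat.mul_pos (Nat.pow_pos (Nat.sub_pos_of_lt (Nat.one_lt_pow hf.ne' hp.one_lt)))
          (Nat.pow_pos hp.pos)
      exact_mod_cast this.trans_le hU
    calc ((X : ℝ) / F) ^ r * (H / s) ≤ H / s :=
          mul_le_of_le_one_left (by positivity) (pow_le_one₀ (by positivity) hXF)
      _ ≤ (h : ℝ) / U := by
          rw [div_le_div_iff₀ hs hUpos]
          exact_mod_cast hHU
      _ ≤ _ := div_le_two_rpow_of_card_bounds hA hB hC hp4 (hprimes p hp hpn) hn
          (hp.factorization_pos_of_dvd hn.ne' hpn) hnp hdw hd hrd hf hg hdfg hh hU hH hH1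
end

section
/- Let n be a positive integer that is not a prime power and has no prime divisor smaller than 1000. Let r and d be positive integers with d ≥ 16 and r·d ≤ 0.13875·log n. Let S be a cyclic extension of ℤ/nℤ of dimension d with generator σ. Then the density of bad witnesses for the product of r Miller–Rabin tests and one Galois test of dimension d, namely #{(x_1,…,x_r,y) ∈ ((ℤ/nℤ)*)^r × S* : every x_i is a Miller–Rabin nonwitness for n and σ(y) = y^n} / ((#(ℤ/nℤ)*)^r · #S*), is at most 2^{−0.41369·r·d}. -/
theorem two_pow_mul_card_pow_eq_one_le {ι : Type*} [Fintype ι] {G : ι → Type*}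
    [∀ i, CommGroup (G i)] [∀ i, Finite (G i)] {M : ℕ} (x : ∀ i, G i)
    (hx : ∀ i, x i ^ M ≠ 1) (hx2 : x ^ (2 * M) = 1) :
    2 ^ Fintype.card ι * Nat.card {y : ∀ i, G i // y ^ M = 1} ≤
      Nat.card {y : ∀ i, G i // y ^ (2 * M) = 1} := by
  classical
  have hcard : 2 ^ Fintype.card ι = Nat.card (Finset ι) := by simp
  rw [hcard, ← Nat.card_prod]
  let s : Finset ι → ∀ i, G i := fun T i ↦ if i ∈ T then x i else 1
  have hs (T : Finset ι) : s T ^ (2 * M) = 1 := by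
    funext i
    by_cases hi : i ∈ T
    · simpa [s, hi] using congrFun hx2 i
    · simp [s, hi]
  refine Nat.card_le_card_of_injective
    (fun p : Finset ι × {y : ∀ i, G i // y ^ M = 1} ↦
      (⟨s p.1 * p.2.1, by rw [mul_pow, hs, mul_comm 2 M, pow_mul, p.2.2]; simp⟩ :
        {y : ∀ i, G i // y ^ (2 * M) = 1})) ?_
  rintro ⟨T, y, hy⟩ ⟨T', y', hy'⟩ h
  have h' : s T * y = s T' * y' := congrArg Subtype.val h
  have hTT : T = T' := by
    have hM : s T ^ M = s T' ^ M := by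
      simpa [mul_pow, hy, hy'] using congrArg (· ^ M) h'
    ext i
    have hi := congrFun hM i
    by_cases h1 : i ∈ T <;> by_cases h2 : i ∈ T' <;> simp [s, h1, h2] at hi ⊢
    · exact hx i hi
    · exact hx i hi.symm
  subst hTT
  simpa using h'

theorem ZMod.two_pow_mul_card_pow_eq_one_le {n : ℕ} [NeZero n] (hn : Odd n) {M : ℕ}
    (x : (ZMod n)ˣ) (hx : x ^ M = -1) :
    2 ^ n.primeFactors.card * Nat.card {y : (ZMod n)ˣ // y ^ M = 1} ≤
      Nat.card {y : (ZMod n)ˣ // y ^ (2 * M) = 1} := by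
  let ψ := ZMod.equivPi n (NeZero.ne n)
  let Ψ : (ZMod n)ˣ ≃* ∀ p : n.primeFactors, (ZMod ((p : ℕ) ^ n.factorization p))ˣ :=
    (Units.mapEquiv ψ.toMulEquiv).trans MulEquiv.piUnits
  have hΨ (N : ℕ) (y : (ZMod n)ˣ) : y ^ N = 1 ↔ Ψ y ^ N = 1 := by
    rw [← map_pow, EmbeddingLike.map_eq_one_iff]
  have key := _root_.two_pow_mul_card_pow_eq_one_le (M := M) (Ψ x) ?_ ?_
  · rwa [Fintype.card_coe, ← Nat.card_congr (Ψ.toEquiv.subtypeEquiv (hΨ M)),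
      ← Nat.card_congr (Ψ.toEquiv.subtypeEquiv (hΨ (2 * M)))] at key
  · intro p hp
    have hpp := Nat.prime_of_mem_primeFactors p.2
    have hpn := Nat.dvd_of_mem_primeFactors p.2
    have h1 : Ψ x ^ M = Ψ (-1) := by rw [← map_pow, hx]
    have h2 : (Ψ (-1) p : ZMod ((p : ℕ) ^ n.factorization p)) = -1 := by
      simp [Ψ]
    have h3 := congrFun h1 p
    rw [Pi.pow_apply, hp] at h3
    rw [← h3, Units.val_one] at h2
    have hf : n.factorization p ≠ 0 :=
      (hpp.factorization_pos_of_dvd (NeZero.ne n) hpn).ne'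
    have hp2 : 2 < (p : ℕ) ^ n.factorization p := by
      have : (p : ℕ) ≠ 2 := by
        intro h
        rw [h] at hpn
        exact (Nat.not_even_iff_odd.2 hn) (even_iff_two_dvd.2 hpn)
      have := hpp.two_le
      exact lt_of_lt_of_le (by lia) (Nat.le_self_pow hf _)
    have : Fact (2 < (p : ℕ) ^ n.factorization p) := ⟨hp2⟩
    exact ZMod.neg_one_ne_one h2.symm
  · rw [← hΨ, mul_comm, pow_mul, hx, neg_one_sq]

theorem two_pow_cardFactors_le {n : ℕ} :
    2 ^ ArithmeticFunction.cardFactors n ≤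
      2 ^ n.primeFactors.card * ∏ p ∈ n.primeFactors, p ^ (n.factorization p - 1) := by
  rw [ArithmeticFunction.cardFactors_eq_sum_factorization, Finsupp.sum,
    Nat.support_factorization, ← Finset.prod_pow_eq_pow_sum, ← Finset.prod_const,
    ← Finset.prod_mul_distrib]
  refine Finset.prod_le_prod' fun p hp ↦ ?_
  have hpp := Nat.prime_of_mem_primeFactors hp
  have hf := hpp.factorization_pos_of_dvd (Nat.mem_primeFactors.1 hp).2.2
    (Nat.dvd_of_mem_primeFactors hp)
  obtain ⟨a, ha⟩ := Nat.exists_eq_succ_of_ne_zero hf.ne'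
  rw [ha, pow_succ', Nat.succ_sub_one]
  exact Nat.mul_le_mul_left _ (Nat.pow_le_pow_left hpp.two_le _)

theorem card_pow_eq_one_mul_le_card_units {n : ℕ} [NeZero n] {N : ℕ} (hN : N.Coprime n) :
    Nat.card {y : (ZMod n)ˣ // y ^ N = 1} *
      ∏ p ∈ n.primeFactors, p ^ (n.factorization p - 1) ≤ Nat.card (ZMod n)ˣ := by
  have hC : Nat.card {y : (ZMod n)ˣ // y ^ N = 1} =
      Nat.card (powMonoidHom N : (ZMod n)ˣ →* (ZMod n)ˣ).ker := rfl
  refine Nat.le_of_dvd Nat.card_pos (Nat.Coprime.mul_dvd_of_dvd_of_dvd ?_ ?_ ?_)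
  · refine Nat.Coprime.prod_right fun p hp ↦ Nat.Coprime.pow_right _ ?_
    have hpp := Nat.prime_of_mem_primeFactors hp
    rw [Nat.coprime_comm, hpp.coprime_iff_not_dvd, hC]
    intro hd
    have : Fact p.Prime := ⟨hpp⟩
    obtain ⟨⟨y, hy⟩, hyo⟩ := exists_prime_orderOf_dvd_card' p hd
    have hyN : y ^ N = 1 := hy
    rw [Subgroup.orderOf_mk] at hyo
    have : p ∣ N := hyo ▸ orderOf_dvd_of_pow_eq_one hyN
    exact hpp.one_lt.ne' (Nat.eq_one_of_dvd_coprimes hN this (Nat.dvd_of_mem_primeFactors hp))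
  · rw [hC]
    exact Subgroup.card_subgroup_dvd_card _
  · rw [Nat.card_eq_fintype_card, ZMod.card_units_eq_totient,
      Nat.totient_eq_prod_factorization (NeZero.ne n), Finsupp.prod, Nat.support_factorization,
      Finset.prod_mul_distrib]
    exact dvd_mul_right _ _

/-- The density of Miller–Rabin nonwitnesses is at most `2 ^ (1 - Ω n)`. -/
theorem card_MRNonwitness_le {n m k : ℕ} (hn1 : 1 < n) (hn : Odd n) (hm : Odd m)
    (hmk : n - 1 = m * 2 ^ k) :
    2 ^ ArithmeticFunction.cardFactors n * Nat.card {x : (ZMod n)ˣ // MRNonwitness n m k x} ≤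
      2 * Nat.card (ZMod n)ˣ := by
  have : NeZero n := ⟨by lia⟩
  have hk : 0 < k := by
    rcases Nat.eq_zero_or_pos k with rfl | h
    · have : Even (n - 1) := Nat.Odd.sub_odd hn odd_one
      rw [hmk, pow_zero, mul_one] at this
      exact absurd this (Nat.not_even_iff_odd.2 hm)
    · exact h
  obtain ⟨j, ⟨hjk, x, hx⟩, hmax⟩ :
      ∃ j, (j < k ∧ ∃ x : (ZMod n)ˣ, x ^ (m * 2 ^ j) = -1) ∧
        ∀ i, i < k → (∃ x : (ZMod n)ˣ, x ^ (m * 2 ^ i) = -1) → i ≤ j := by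
    classical
    let s := (Finset.range k).filter fun i ↦ ∃ x : (ZMod n)ˣ, x ^ (m * 2 ^ i) = -1
    have hs : s.Nonempty := ⟨0, by simpa [s, hk] using ⟨-1, hm.neg_one_pow⟩⟩
    refine ⟨s.max' hs, by simpa [s] using s.max'_mem hs, fun i hi hix ↦ s.le_max' i ?_⟩
    simpa [s] using ⟨hi, hix⟩
  set M := m * 2 ^ j with hM
  have hNW (y : (ZMod n)ˣ) (hy : MRNonwitness n m k y) : y ^ M = 1 ∨ y ^ M = -1 := by
    rcases hy with h | ⟨i, hi, h⟩
    · left; rw [hM, pow_mul, h, one_pow]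
    · rcases (hmax i hi ⟨y, h⟩).eq_or_lt with rfl | hij
      · exact .inr h
      · left
        obtain ⟨c, rfl⟩ := Nat.exists_eq_add_of_lt hij
        rw [hM, show m * 2 ^ (i + c + 1) = m * 2 ^ i * (2 * 2 ^ c) by ring, pow_mul, h, pow_mul,
          neg_one_sq, one_pow]
  have hle : Nat.card {x : (ZMod n)ˣ // MRNonwitness n m k x} ≤
      2 * Nat.card {y : (ZMod n)ˣ // y ^ M = 1} := by
    classical
    rw [show 2 = Nat.card Bool by simp, ← Nat.card_prod]
    have hmem (y : {x : (ZMod n)ˣ // MRNonwitness n m k x}) :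
        (y.1 * if y.1 ^ M = 1 then 1 else x⁻¹) ^ M = 1 := by
      split_ifs with h
      · rw [mul_one, h]
      · rw [mul_pow, inv_pow, hx, (hNW _ y.2).resolve_left h, mul_inv_cancel]
    refine Nat.card_le_card_of_injective
      (fun y ↦ (⟨decide (y.1 ^ M = 1), _, hmem y⟩ : Bool × {y : (ZMod n)ˣ // y ^ M = 1})) ?_
    rintro ⟨y, hy⟩ ⟨z, hz⟩ h
    simp only [Prod.mk.injEq, decide_eq_decide, Subtype.mk.injEq] at h
    obtain ⟨h1, h2⟩ := h
    simp only [h1] at h2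
    exact Subtype.ext (mul_right_cancel h2)
  have hcop : (2 * M).Coprime n := by
    have hd : 2 * M ∣ n - 1 := by
      rw [hmk, hM, show 2 * (m * 2 ^ j) = m * 2 ^ (j + 1) by ring]
      exact Nat.mul_dvd_mul_left _ (pow_dvd_pow _ hjk)
    refine Nat.Coprime.coprime_dvd_left hd ?_
    exact (Nat.coprime_self_sub_left hn1.le).2 (Nat.coprime_one_left _)
  have h1 := ZMod.two_pow_mul_card_pow_eq_one_le hn x hx
  have h2 := card_pow_eq_one_mul_le_card_units hcop
  have h3 := two_pow_cardFactors_le (n := n)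
  set P := ∏ p ∈ n.primeFactors, p ^ (n.factorization p - 1)
  set A := Nat.card {y : (ZMod n)ˣ // y ^ M = 1}
  calc _ ≤ (2 ^ n.primeFactors.card * P) * (2 * A) := Nat.mul_le_mul h3 hle
    _ = 2 * ((2 ^ n.primeFactors.card * A) * P) := by ring
    _ ≤ _ := Nat.mul_le_mul_left _ ((Nat.mul_le_mul_right _ h1).trans h2)

theorem Subgroup.card_mul_card_le_card_map_mul_card {G X : Type*} [Group G] [Group X] [Finite G]
    (H : Subgroup G) (f : G →* X) (hf : Function.Surjective f) :
    Nat.card H * Nat.card X ≤ Nat.card (H.map f) * Nat.card G := by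
  have h1 := f.ker.card_mul_index
  rw [Subgroup.index_ker, MonoidHom.range_eq_top.2 hf, Subgroup.card_top] at h1
  have h2 := (f.comp H.subtype).ker.card_mul_index
  rw [Subgroup.index_ker, MonoidHom.range_comp, Subgroup.range_subtype] at h2
  have h3 : Nat.card (f.comp H.subtype).ker ≤ Nat.card f.ker :=
    Nat.card_le_card_of_injective (fun y ↦ (⟨y.1.1, y.2⟩ : f.ker))
      fun y z h ↦ Subtype.ext (Subtype.ext (Subtype.mk.inj h))
  rw [← h1, ← h2]
  nlinarith [Nat.mul_le_mul_right (Nat.card (H.map f) * Nat.card X) h3]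

theorem card_units_pow_eq_pow_le {K : Type*} [Field K] {a b : ℕ} (hab : a ≠ b) :
    Nat.card {u : Kˣ // u ^ a = u ^ b} ≤ max a b := by
  classical
  let P : Polynomial K := Polynomial.X ^ a - Polynomial.X ^ b
  have hP : P ≠ 0 := by
    intro h
    have := congrArg (fun Q ↦ Polynomial.coeff Q a) h
    simp [P, Polynomial.coeff_X_pow, hab] at this
  have hdeg : P.natDegree ≤ max a b := by
    simpa using Polynomial.natDegree_sub_le (Polynomial.X ^ a : Polynomial K) (Polynomial.X ^ b)
  refine le_trans ?_ ((Multiset.toFinset_card_le _).trans ((Polynomial.card_roots' P).trans hdeg))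
  rw [← Nat.card_eq_finsetCard]
  refine Nat.card_le_card_of_injective
    (fun u ↦ (⟨u.1, ?_⟩ : P.roots.toFinset)) fun u v h ↦ ?_
  · have := congrArg Units.val u.2
    simpa [hP, P, sub_eq_zero] using this
  · exact Subtype.ext (Units.ext (congrArg Subtype.val h))

theorem FiniteField.exists_ringHom_eq_pow {K : Type*} [Field K] [Finite K] (q : ℕ) [Fact q.Prime]
    [CharP K q] (τ : K →+* K) :
    ∃ f s : ℕ, s < f ∧ Nat.card K = q ^ f ∧ ∀ x, τ x = x ^ q ^ s := by
  let := ZMod.algebra K q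
  let τ' : K →ₐ[ZMod q] K := 
    { τ with
      commutes' := fun c ↦ RingHom.congr_fun
        (RingHom.ext_zmod (τ.comp (algebraMap _ _)) (algebraMap _ _)) c }
  obtain ⟨⟨s, hs⟩, h⟩ := (FiniteField.bijective_frobeniusAlgHom_pow (ZMod q) K).2 τ'
  refine ⟨Module.finrank (ZMod q) K, s, hs, ?_, fun x ↦ ?_⟩
  · simpa using Module.natCard_eq_pow_finrank (K := ZMod q) (V := K)
  · have := congrArg (fun g : K →ₐ[ZMod q] K ↦ g x) h
    change _ = τ x at this
    rw [← this]
    simp [FiniteField.coe_frobeniusAlgHom, pow_iterate]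

theorem exists_unit_forall_sub_mem {S ι : Type*} [CommRing S] [Finite S] (I : ι → Ideal S)
    (hI : ∀ i, (I i).IsMaximal) (hinj : Function.Injective I) (v : ι → S)
    (hv : ∀ i, v i ∉ I i) : ∃ y : Sˣ, ∀ i, (y : S) - v i ∈ I i := by
  classical
  let w : MaximalSpectrum S → S := fun N ↦
    if h : ∃ i, I i = N.asIdeal then v h.choose else 1
  have hw (i : ι) : w ⟨I i, hI i⟩ = v i := by
    have h : ∃ j, I j = I i := ⟨i, rfl⟩
    simp only [w, dif_pos h]
    exact congrArg v (hinj h.choose_spec)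
  have hw' (N : MaximalSpectrum S) : w N ∉ N.asIdeal := by
    by_cases h : ∃ i, I i = N.asIdeal
    · simp only [w, dif_pos h]
      have := hv h.choose
      rwa [h.choose_spec] at this
    · simp only [w, dif_neg h]
      exact fun h1 ↦ N.isMaximal.ne_top ((Ideal.eq_top_iff_one _).2 h1)
  obtain ⟨y, hy⟩ := Ideal.exists_forall_sub_mem_ideal
    (I := fun N : MaximalSpectrum S ↦ N.asIdeal)
    (fun N N' h ↦ (Ideal.isCoprime_iff_sup_eq.2
      (N.isMaximal.coprime_of_ne N'.isMaximal fun hh ↦ h (MaximalSpectrum.ext hh)))) w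
  have hu : IsUnit y := by
    by_contra hnu
    obtain ⟨N, hN, hyN⟩ := exists_max_ideal_of_mem_nonunits hnu
    exact hw' ⟨N, hN⟩ ((sub_sub_cancel y (w ⟨N, hN⟩)) ▸ N.sub_mem hyN (hy ⟨N, hN⟩))
  refine ⟨hu.unit, fun i ↦ ?_⟩
  have := hy ⟨I i, hI i⟩
  rwa [hw] at this

/-- Units on which `σ` acts as raising to the `n`-th power. -/
def galoisNonwitness {R S : Type*} [CommRing R] [CommRing S] [Algebra R S]
    (σ : S ≃ₐ[R] S) (n : ℕ) : Subgroup Sˣ :=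
  (Units.map (σ : S →* S)).eqLocus (powMonoidHom n)

section GaloisTest

variable {R S : Type*} [CommRing R] [CommRing S] [Algebra R S] {σ : S ≃ₐ[R] S} {n : ℕ}

theorem mem_galoisNonwitness {y : Sˣ} : y ∈ galoisNonwitness σ n ↔ σ (y : S) = (y : S) ^ n := by
  exact ⟨fun h ↦ congrArg Units.val h, fun h ↦ Units.ext h⟩

theorem pow_apply_of_mem_galoisNonwitness {y : Sˣ} (hy : y ∈ galoisNonwitness σ n) (j : ℕ) :
    (σ ^ j) (y : S) = (y : S) ^ n ^ j := by
  induction j with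
  | zero => simp
  | succ j ih =>
    rw [pow_succ', AlgEquiv.mul_apply, ih, map_pow, mem_galoisNonwitness.1 hy, ← pow_mul,
      pow_succ']

theorem mem_iterate_comap {M : Ideal S} {j : ℕ} {x : S} :
    x ∈ (Ideal.comap σ)^[j] M ↔ (σ ^ j) x ∈ M := by
  induction j generalizing x with
  | zero => simp
  | succ j ih => rw [Function.iterate_succ_apply', Ideal.mem_comap, ih, pow_succ]; rfl

/-- Reduction of the conjugates `y, σ y, …, σ ^ (e - 1) y` modulo `M`. -/
def conjugatesMod (σ : S ≃ₐ[R] S) (M : Ideal S) (e : ℕ) : Sˣ →* (Fin e → (S ⧸ M)ˣ) :=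
  MonoidHom.pi fun j ↦
    Units.map ((Ideal.Quotient.mk M : S →* S ⧸ M).comp ((σ ^ (j : ℕ) : S ≃ₐ[R] S) : S →* S))

theorem coe_conjugatesMod_apply (M : Ideal S) {e : ℕ} (y : Sˣ) (j : Fin e) :
    (conjugatesMod σ M e y j : S ⧸ M) = Ideal.Quotient.mk M ((σ ^ (j : ℕ)) (y : S)) := rfl

theorem conjugatesMod_surjective [Finite S] {M : Ideal S} [hM : M.IsMaximal] :
    Function.Surjective
      (conjugatesMod σ M (Function.minimalPeriod (Ideal.comap σ) M)) := by
  set e := Function.minimalPeriod (Ideal.comap σ) M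
  intro u
  choose v hv using fun j ↦ Ideal.Quotient.mk_surjective (u j : S ⧸ M)
  have hmax (j : ℕ) : ((Ideal.comap σ)^[j] M).IsMaximal := by
    induction j with
    | zero => exact hM
    | succ j ih =>
      rw [Function.iterate_succ_apply']
      exact Ideal.comap_isMaximal_of_equiv σ
  obtain ⟨y, hy⟩ := exists_unit_forall_sub_mem
    (fun j : Fin e ↦ (Ideal.comap σ)^[(j : ℕ)] M) (fun j ↦ hmax j)
    (fun i j h ↦ Fin.ext (Function.iterate_injOn_Iio_minimalPeriod i.2 j.2 h))
    (fun j ↦ (σ ^ (j : ℕ)).symm (v j)) (fun j hj ↦ by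
      rw [mem_iterate_comap, AlgEquiv.apply_symm_apply] at hj
      have := (u j).ne_zero
      rw [← hv, Ne, Ideal.Quotient.eq_zero_iff_mem] at this
      exact this hj)
  refine ⟨y, funext fun j ↦ Units.ext ?_⟩
  rw [coe_conjugatesMod_apply, ← hv, Ideal.Quotient.eq]
  have := mem_iterate_comap.1 (hy j)
  rwa [map_sub, AlgEquiv.apply_symm_apply] at this

theorem card_units_quotient [Finite S] {M : Ideal S} [M.IsMaximal] :
    Nat.card (S ⧸ M)ˣ = Nat.card (S ⧸ M) - 1 := by
  have : Finite (S ⧸ M) := .of_surjective _ Ideal.Quotient.mk_surjective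
  let := Ideal.Quotient.field M
  have := Fintype.ofFinite (S ⧸ M)
  exact Nat.card_units (S ⧸ M)

theorem card_map_conjugatesMod_le [Finite S] {M : Ideal S} {e : ℕ} (he : 0 < e) :
    Nat.card ((galoisNonwitness σ n).map (conjugatesMod σ M e)) ≤ Nat.card (S ⧸ M)ˣ := by
  have : Finite (S ⧸ M) := .of_surjective _ Ideal.Quotient.mk_surjective
  refine Nat.card_le_card_of_injective (fun z ↦ z.1 ⟨0, he⟩) ?_
  rintro ⟨_, y, hy, rfl⟩ ⟨_, z, hz, rfl⟩ h
  refine Subtype.ext (funext fun j ↦ Units.ext ?_)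
  have h0 : Ideal.Quotient.mk M (y : S) = Ideal.Quotient.mk M (z : S) := by
    simpa [coe_conjugatesMod_apply] using congrArg Units.val h
  simp only [coe_conjugatesMod_apply, pow_apply_of_mem_galoisNonwitness hy,
    pow_apply_of_mem_galoisNonwitness hz, map_pow, h0]

theorem card_galoisNonwitness_mul_le [Finite S] {M : Ideal S} [M.IsMaximal] {q d : ℕ}
    (hq : q.Prime) (hqM : (q : S) ∈ M) (hn1 : 1 < n) (hn : ¬ IsPrimePow n) (hd : 0 < d)
    (hσ : σ ^ d = 1) (hunram : ∀ i, 0 < i → i < d → ∃ x : S, (σ ^ i) x - x ∉ M) :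
    (∃ f, d ≤ f ∧
      Nat.card (galoisNonwitness σ n) * (q ^ f - 1) ≤ n * q ^ (f / 2) * Nat.card Sˣ) ∨
    ∃ e f, 2 ≤ e ∧ 0 < f ∧ d ≤ e * f ∧
      Nat.card (galoisNonwitness σ n) * (q ^ f - 1) ^ (e - 1) ≤ Nat.card Sˣ := by
  have : Fact q.Prime := ⟨hq⟩
  have : Finite (S ⧸ M) := .of_surjective _ Ideal.Quotient.mk_surjective
  let := Ideal.Quotient.field M
  have hchar : CharP (S ⧸ M) q := by
    refine (CharP.charP_iff_prime_eq_zero hq).2 ?_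
    rw [← map_natCast (Ideal.Quotient.mk M), Ideal.Quotient.eq_zero_iff_mem]
    exact hqM
  have hper : Function.IsPeriodicPt (Ideal.comap σ) d M := by
    refine Ideal.ext fun x ↦ ?_
    rw [mem_iterate_comap, hσ]; rfl
  set e := Function.minimalPeriod (Ideal.comap σ) M with he
  have he0 : 0 < e := hper.minimalPeriod_pos hd
  obtain ⟨g, hg⟩ : e ∣ d := hper.minimalPeriod_dvd
  have hMe : M = Ideal.comap (σ ^ e : S ≃ₐ[R] S) M := by
    refine Ideal.ext fun x ↦ ?_
    rw [Ideal.mem_comap, ← mem_iterate_comap, he, Function.iterate_minimalPeriod]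
  let τ : S ⧸ M →+* S ⧸ M :=
    Ideal.quotientMap M ((σ ^ e : S ≃ₐ[R] S) : S →+* S) hMe.le
  have hτ (x : S) : τ (Ideal.Quotient.mk M x) = Ideal.Quotient.mk M ((σ ^ e) x) := rfl
  have hτi (i : ℕ) (x : S) :
      τ^[i] (Ideal.Quotient.mk M x) = Ideal.Quotient.mk M ((σ ^ (e * i)) x) := by
    induction i with
    | zero => simp
    | succ i ih =>
      rw [Function.iterate_succ_apply', ih, hτ, mul_add, mul_one, add_comm, pow_add]; rfl
  obtain ⟨f, s, hsf, hcard, hpow⟩ := FiniteField.exists_ringHom_eq_pow q τ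
  have hfix (x : S ⧸ M) : x ^ q ^ f = x := by
    have := Fintype.ofFinite (S ⧸ M)
    rw [← hcard, Nat.card_eq_fintype_card, FiniteField.pow_card]
  have hgf : g ≤ f := by
    by_contra! h
    obtain ⟨x, hx⟩ := hunram (e * f) (Nat.mul_pos he0 (by lia))
      (hg ▸ Nat.mul_lt_mul_of_pos_left h he0)
    refine hx (Ideal.Quotient.eq.1 ?_)
    rw [← hτi]
    have hit (i : ℕ) (z : S ⧸ M) : τ^[i] z = z ^ (q ^ s) ^ i := by
      induction i with
      | zero => simp
      | succ i ih => rw [Function.iterate_succ_apply', ih, hpow, ← pow_mul, pow_succ]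
    have hfix' (i : ℕ) (z : S ⧸ M) : z ^ (q ^ f) ^ i = z := by
      induction i with
      | zero => simp
      | succ i ih => rw [pow_succ, pow_mul, ih, hfix]
    rw [hit, pow_right_comm, hfix']
  have hmain := (galoisNonwitness σ n).card_mul_card_le_card_map_mul_card _
    (conjugatesMod_surjective (σ := σ) (M := M))
  have hK : Nat.card (S ⧸ M)ˣ = q ^ f - 1 := by rw [card_units_quotient, hcard]
  rw [← he, Nat.card_fun, hK, Nat.card_fin] at hmain
  rcases Nat.lt_or_ge 1 e with he2 | he1
  · refine .inr ⟨e, f, he2, by lia, hg ▸ Nat.mul_le_mul_left _ hgf, ?_⟩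
    have h1 := hmain.trans (Nat.mul_le_mul_right _ (card_map_conjugatesMod_le he0))
    rw [hK] at h1
    obtain ⟨c, hc⟩ : ∃ c, e = c + 1 := ⟨e - 1, by lia⟩
    have hpos : 0 < q ^ f - 1 := hK ▸ Nat.card_pos
    rw [hc, pow_succ', mul_left_comm] at h1
    rw [hc, Nat.add_sub_cancel]
    exact Nat.le_of_mul_le_mul_left h1 hpos
  · have he1 : e = 1 := by lia
    refine .inl ⟨f, by rw [hg, he1, one_mul]; exact hgf, ?_⟩
    rw [he1, pow_one] at hmain
    refine hmain.trans (Nat.mul_le_mul_right _ ?_)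
    have hqs (z : (galoisNonwitness σ n).map (conjugatesMod σ M 1)) :
        z.1 0 ^ n = z.1 0 ^ q ^ s := by
      obtain ⟨_, y, hy, rfl⟩ := z
      refine Units.ext ?_
      simp only [Units.val_pow_eq_pow_val, coe_conjugatesMod_apply, ← hpow, Fin.val_zero, pow_zero]
      rw [← map_pow, AlgEquiv.one_apply, hτ, he1, pow_one, mem_galoisNonwitness.1 hy]
    have hinj {P : (S ⧸ M)ˣ → Prop}
        (hP : ∀ z : (galoisNonwitness σ n).map (conjugatesMod σ M 1), P (z.1 0)) :
        Nat.card ((galoisNonwitness σ n).map (conjugatesMod σ M 1)) ≤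
          Nat.card {u : (S ⧸ M)ˣ // P u} := by
      refine Nat.card_le_card_of_injective (fun z ↦ ⟨z.1 0, hP z⟩) fun z w h ↦ ?_
      refine Subtype.ext (funext fun j ↦ ?_)
      rw [Subsingleton.elim j 0]
      exact Subtype.mk.inj h
    have hqf : 0 < q ^ (f / 2) := Nat.pow_pos hq.pos
    rcases Nat.lt_or_ge (f / 2) s with hs | hs
    · refine (hinj (P := fun u ↦ u ^ (n * q ^ (f - s)) = u ^ 1) fun z ↦ ?_).trans
        ((card_units_pow_eq_pow_le ?_).trans ?_)
      · rw [pow_mul, hqs, ← pow_mul, ← pow_add, Nat.add_sub_cancel' hsf.le, pow_one]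
        exact Units.ext (hfix _)
      · have := Nat.pow_pos (n := f - s) hq.pos
        nlinarith
      · have h1 : q ^ (f - s) ≤ q ^ (f / 2) := Nat.pow_le_pow_right hq.pos (by lia)
        exact max_le (Nat.mul_le_mul_left _ h1) (Nat.mul_pos (by lia) hqf)
    · refine (hinj hqs).trans ((card_units_pow_eq_pow_le ?_).trans ?_)
      · rintro rfl
        rcases Nat.eq_zero_or_pos s with rfl | hs0
        · simp at hn1
        · exact hn (hq.isPrimePow.pow hs0.ne')
      · have h1 : q ^ s ≤ q ^ (f / 2) := Nat.pow_le_pow_right hq.pos hs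
        exact max_le (Nat.le_mul_of_pos_right _ hqf) (h1.trans (Nat.le_mul_of_pos_left _ (by lia)))

end GaloisTest

theorem exists_prime_dvd_le_pow_cardFactors {n : ℕ} (hn : 1 < n) :
    ∃ q, q.Prime ∧ q ∣ n ∧ n ≤ q ^ ArithmeticFunction.cardFactors n := by
  have hne : n.primeFactors.Nonempty := Nat.nonempty_primeFactors.2 hn
  have hmem := n.primeFactors.max'_mem hne
  refine ⟨n.primeFactors.max' hne, Nat.prime_of_mem_primeFactors hmem,
    Nat.dvd_of_mem_primeFactors hmem, ?_⟩
  rw [ArithmeticFunction.cardFactors_apply]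
  conv_lhs => rw [← Nat.prod_primeFactorsList (by lia : n ≠ 0)]
  exact List.prod_le_pow_card _ _ fun p hp ↦
    Finset.le_max' _ _ (Nat.mem_primeFactors_iff_mem_primeFactorsList.2 hp)

/-- A nontrivial divisor of `n` is a nonunit in any faithful `ZMod n`-algebra. -/
theorem exists_isMaximal_natCast_mem {n q : ℕ} [NeZero n] {S : Type*} [CommRing S]
    [Algebra (ZMod n) S] (hS : Function.Injective (algebraMap (ZMod n) S)) (hq : 1 < q)
    (hqn : q ∣ n) : ∃ M : Ideal S, M.IsMaximal ∧ (q : S) ∈ M := by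
  refine exists_max_ideal_of_mem_nonunits (a := (q : S)) fun hu ↦ ?_
  have hchar : CharP S n := charP_of_injective_ringHom hS n
  obtain ⟨c, hc⟩ := hqn
  have h0 : (q : S) * (c : S) = 0 := by
    rw [← Nat.cast_mul, ← hc, CharP.cast_eq_zero]
  have hc0 : (c : S) = 0 := (hu.mul_right_eq_zero).1 h0
  have hdvd := (CharP.cast_eq_zero_iff S n c).1 hc0
  have hn := NeZero.pos n
  have hcpos : 0 < c := Nat.pos_of_ne_zero fun h ↦ by simp [h] at hc; lia
  have := Nat.le_of_dvd hcpos hdvd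
  nlinarith

theorem half_pow_le_pow_sub_one {q f : ℕ} (hq : 2 ≤ q) (hf : 0 < f) :
    Real.exp (f * Real.log q) / 2 ≤ ((q ^ f - 1 : ℕ) : ℝ) := by
  have h1 : Real.exp (f * Real.log q) = (q : ℝ) ^ f := by
    rw [Real.exp_nat_mul, Real.exp_log (by positivity)]
  have h2 : 2 ≤ q ^ f := hq.trans (Nat.le_self_pow hf.ne' q)
  rw [h1, Nat.cast_sub (by lia)]
  have h3 : (2 : ℝ) ≤ (q : ℝ) ^ f := by exact_mod_cast h2
  push_cast
  linarith

theorem div_le_exp_of_mul_le {a b c B : ℝ} (hb : 0 < b) (hc : 0 < c) {t : ℝ}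
    (h : a * c ≤ B * b) (hB : B ≤ c * Real.exp t) : a / b ≤ Real.exp t := by
  rw [div_le_iff₀ hb]
  have : a * c ≤ (Real.exp t * b) * c := by
    nlinarith [mul_le_mul_of_nonneg_right hB hb.le]
  exact le_of_mul_le_mul_right this hc

/-- The numerical estimate for the Galois test when `n` has few prime factors. -/
theorem galoisNonwitness_density_le {n q d H U : ℕ} {L : ℝ} (hn : 0 < n) (hL : Real.log n = L)
    (hL1 : 115 ≤ L) (hq : 1000 ≤ q) (hU : 0 < U) (hdq : 2.099 * L ≤ d * Real.log q)
    (hd : 0 < d)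
    (h : (∃ f, d ≤ f ∧ H * (q ^ f - 1) ≤ n * q ^ (f / 2) * U) ∨
      ∃ e f, 2 ≤ e ∧ 0 < f ∧ d ≤ e * f ∧ H * (q ^ f - 1) ^ (e - 1) ≤ U) :
    (H : ℝ) / U ≤ Real.exp (-(0.0398 * L)) := by
  have hU' : (0 : ℝ) < U := by exact_mod_cast hU
  have hq0 : (0 : ℝ) < q := by positivity
  have hlog2 := Real.log_two_lt_d9
  have hlog : 1.4 ≤ Real.log q := by
    have h1 : Real.log ((2 : ℝ) ^ 9) ≤ Real.log q :=
      Real.log_le_log (by norm_num) (by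
        have : (1000 : ℝ) ≤ q := by exact_mod_cast hq
        linarith)
    rw [Real.log_pow] at h1
    have := Real.log_two_gt_d9
    push_cast at h1
    linarith
  have hnexp : (n : ℝ) = Real.exp L := by rw [← hL, Real.exp_log (by exact_mod_cast hn)]
  have h2exp : (2 : ℝ) = Real.exp (Real.log 2) := (Real.exp_log (by norm_num)).symm
  rcases h with ⟨f, hdf, h⟩ | ⟨e, f, he, hf, hdef, h⟩
  · have hpow := half_pow_le_pow_sub_one (q := q) (f := f) (by lia) (by lia)
    have hpos : 0 < Real.exp (f * Real.log q) / 2 := by positivity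
    refine div_le_exp_of_mul_le (B := n * (q : ℝ) ^ (f / 2)) hU' (hpos.trans_le hpow)
      (by exact_mod_cast h) ?_
    refine le_trans ?_ (mul_le_mul_of_nonneg_right hpow (Real.exp_pos _).le)
    have hqf : (q : ℝ) ^ (f / 2) = Real.exp ((f / 2 : ℕ) * Real.log q) := by
      rw [Real.exp_nat_mul, Real.exp_log hq0]
    rw [hqf, hnexp, ← Real.exp_add, h2exp, ← Real.exp_sub, ← Real.exp_add, Real.exp_le_exp]
    have h1 : ((f / 2 : ℕ) : ℝ) ≤ f / 2 := Nat.cast_div_le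
    have h2 : (d : ℝ) ≤ f := by exact_mod_cast hdf
    nlinarith [mul_le_mul_of_nonneg_right h1 (by linarith : 0 ≤ Real.log q),
      mul_le_mul_of_nonneg_right h2 (by linarith : 0 ≤ Real.log q)]
  · have hpow := half_pow_le_pow_sub_one (q := q) (f := f) (by lia) hf
    have hpos : 0 < Real.exp (f * Real.log q) / 2 := by positivity
    refine div_le_exp_of_mul_le (B := 1) hU' (pow_pos (hpos.trans_le hpow) (e - 1))
      (by rw [one_mul]; exact_mod_cast h) ?_
    refine le_trans ?_ (mul_le_mul_of_nonneg_right
      (pow_le_pow_left₀ hpos.le hpow (e - 1)) (Real.exp_pos _).le)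
    rw [h2exp, ← Real.exp_sub, ← Real.exp_nat_mul, ← Real.exp_add, Real.one_le_exp_iff]
    have hf1 : (1 : ℝ) ≤ f := by exact_mod_cast hf
    have h1 : f * Real.log q / 2 ≤ f * Real.log q - Real.log 2 := by nlinarith
    have h2 : (d : ℝ) ≤ e * f := by exact_mod_cast hdef
    have h3 : ((e - 1 : ℕ) : ℝ) = e - 1 := by push_cast [Nat.one_le_of_lt he]; ring
    have he' : (2 : ℝ) ≤ e := by exact_mod_cast he
    have h4 : d * Real.log q ≤ e * (f * Real.log q) := by nlinarith
    have h5 : 0 ≤ f * Real.log q := by positivity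
    rw [h3]
    have h6 : (e - 1) * (f * Real.log q / 2) ≤ (e - 1) * (f * Real.log q - Real.log 2) :=
      mul_le_mul_of_nonneg_left h1 (by linarith)
    nlinarith

/-- Let `n` be a positive integer, not a prime power, with no prime divisor smaller
than `1000`. Let `r, d` be positive integers with `d ≥ 16` and `r·d ≤ 0.13875·log n`,
and let `S` be a cyclic extension of `ℤ/nℤ` of dimension `d` with generator `σ`.
Then the density of bad witnesses for the product of `r` Miller–Rabin tests and one
Galois test of dimension `d` is at most `2^(-0.41369·r·d)`. -/
theorem stmt_4 (n : ℕ) (hn : 0 < n) (hnpp : ¬ IsPrimePow n)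
    (hprimes : ∀ q : ℕ, q.Prime → q ∣ n → 1000 ≤ q)
    (r d : ℕ) (hr : 0 < r) (hd : 16 ≤ d)
    (hrd : (r : ℝ) * d ≤ 0.13875 * Real.log n)
    (S : Type*) [CommRing S] [Fintype S] [Algebra (ZMod n) S]
    (hfaithful : Function.Injective (algebraMap (ZMod n) S))
    (σ : S ≃ₐ[ZMod n] S) (hord : orderOf σ = d)
    (hfix : ∀ x : S, σ x = x ↔ x ∈ Set.range (algebraMap (ZMod n) S))
    (hunram : ∀ M : Ideal S, M.IsMaximal → ∀ i : ℕ, 0 < i → i < d →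
      ∃ x : S, (σ ^ i) x - x ∉ M)
    (m k : ℕ) (hm : Odd m) (hmk : n - 1 = m * 2 ^ k) :
    (Nat.card {w : (Fin r → (ZMod n)ˣ) × Sˣ //
        (∀ i : Fin r, MRNonwitness n m k (w.1 i)) ∧ σ (w.2 : S) = (w.2 : S) ^ n} : ℝ) /
      ((Nat.card (ZMod n)ˣ : ℝ) ^ r * (Nat.card Sˣ : ℝ)) ≤
      (2 : ℝ) ^ (-(0.41369 : ℝ) * r * d) := by
  have : NeZero n := ⟨hn.ne'⟩
  have hr' : (1 : ℝ) ≤ r := by exact_mod_cast hr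
  have hd' : (16 : ℝ) ≤ d := by exact_mod_cast hd
  have hL1 : 115 ≤ Real.log n := by nlinarith
  have hn1 : 1 < n := by
    rcases (Nat.succ_le_of_lt hn).eq_or_lt with h | h
    · rw [← h] at hL1; norm_num at hL1
    · exact h
  have hodd : Odd n := by
    rw [← Nat.not_even_iff_odd, even_iff_two_dvd]
    intro h
    have := hprimes 2 Nat.prime_two h
    lia
  let N := {x : (ZMod n)ˣ // MRNonwitness n m k x}
  have hcard : Nat.card {w : (Fin r → (ZMod n)ˣ) × Sˣ //
      (∀ i : Fin r, MRNonwitness n m k (w.1 i)) ∧ σ (w.2 : S) = (w.2 : S) ^ n} =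
      Nat.card N ^ r * Nat.card (galoisNonwitness σ n) := by
    rw [Nat.card_congr (Equiv.subtypeProdEquivProd
      (p := fun x : Fin r → (ZMod n)ˣ ↦ ∀ i, MRNonwitness n m k (x i))
      (q := fun y : Sˣ ↦ σ (y : S) = (y : S) ^ n)), Nat.card_prod,
      Nat.card_congr (Equiv.subtypePiEquivPi (p := fun _ ↦ MRNonwitness n m k)), Nat.card_fun,
      Nat.card_fin]
    exact congrArg _ (Nat.card_congr (Equiv.subtypeEquivRight fun y ↦ mem_galoisNonwitness.symm))
  rw [hcard]
  push_cast
  rw [mul_div_mul_comm, ← div_pow]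
  have hG : (0 : ℝ) < Nat.card (ZMod n)ˣ := by exact_mod_cast Nat.card_pos
  have hSu : (0 : ℝ) < Nat.card Sˣ := by exact_mod_cast Nat.card_pos
  have hN1 : (Nat.card N : ℝ) / Nat.card (ZMod n)ˣ ≤ 1 :=
    div_le_one_of_le₀ (by exact_mod_cast Finite.card_subtype_le _) hG.le
  have hH1 : (Nat.card (galoisNonwitness σ n) : ℝ) / Nat.card Sˣ ≤ 1 :=
    div_le_one_of_le₀ (by exact_mod_cast Subgroup.card_le_card_group _) hSu.le
  set w := ArithmeticFunction.cardFactors n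
  rcases le_or_gt (0.41369 * (d : ℝ)) ((w : ℝ) - 1) with hwd | hwd
  · have hMR := card_MRNonwitness_le hn1 hodd hm hmk
    have hMR' : (Nat.card N : ℝ) / Nat.card (ZMod n)ˣ ≤ (2 : ℝ) ^ (-((w : ℝ) - 1)) := by
      have h1 : (2 : ℝ) ^ w * Nat.card N ≤ 2 * Nat.card (ZMod n)ˣ := by exact_mod_cast hMR
      rw [neg_sub, Real.rpow_sub two_pos, Real.rpow_one, Real.rpow_natCast,
        div_le_div_iff₀ hG (by positivity), mul_comm]
      exact h1
    calc _ ≤ ((2 : ℝ) ^ (-((w : ℝ) - 1))) ^ r * 1 :=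
          mul_le_mul (pow_le_pow_left₀ (by positivity) hMR' r) hH1 (by positivity) (by positivity)
      _ = (2 : ℝ) ^ (-((w : ℝ) - 1) * r) := by
          rw [mul_one, Real.rpow_mul two_pos.le, Real.rpow_natCast]
      _ ≤ _ := Real.rpow_le_rpow_of_exponent_le one_le_two (by nlinarith)
  · obtain ⟨q, hq, hqn, hqw⟩ := exists_prime_dvd_le_pow_cardFactors hn1
    obtain ⟨M, hM, hqM⟩ := exists_isMaximal_natCast_mem hfaithful hq.one_lt hqn
    have hLq : Real.log n ≤ w * Real.log q := by
      rw [← Real.log_pow]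
      exact Real.log_le_log (by exact_mod_cast hn) (by exact_mod_cast hqw)
    have hlogq : 0 ≤ Real.log q := Real.log_natCast_nonneg q
    have hdq : 2.099 * Real.log n ≤ d * Real.log q := by
      have : (w : ℝ) ≤ 0.47619 * d := by linarith
      nlinarith [mul_le_mul_of_nonneg_right this hlogq]
    have hGal := galoisNonwitness_density_le hn rfl hL1 (hprimes q hq hqn) Nat.card_pos hdq
      (by lia) (card_galoisNonwitness_mul_le (σ := σ) (d := d) hq hqM hn1 hnpp (by lia)
        (hord ▸ pow_orderOf_eq_one σ) (hunram M hM))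
    calc _ ≤ 1 * Real.exp (-(0.0398 * Real.log n)) :=
          mul_le_mul (pow_le_one₀ (by positivity) hN1) hGal (by positivity) zero_le_one
      _ ≤ _ := by
          rw [one_mul, Real.rpow_def_of_pos two_pos, Real.exp_le_exp]
          have := Real.log_two_lt_d9
          have h0 : (0 : ℝ) ≤ r * d := by positivity
          nlinarith [mul_le_mul_of_nonneg_left this.le h0]
end

section
/- Let n ≥ 1, p ≥ 2, d ≥ 2 and t be integers with 1 ≤ t ≤ d − 1 and n ≠ p^t. Then gcd(n − p^t, p^d − 1) ≤ n · p^{d/2}, where p^{d/2} denotes the real number p raised to the real exponent d/2. -/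
/-- A nonzero difference of positive integers bounds its gcd with anything by their product. -/
theorem Int.gcd_natCast_sub_natCast_le_mul {a b : ℕ} (ha : 1 ≤ a) (hb : 1 ≤ b) (hab : a ≠ b)
    (c : ℤ) : Int.gcd ((a : ℤ) - b) c ≤ a * b := by
  have hpos : 0 < ((a : ℤ) - b).natAbs := by omega
  have hle : Int.gcd ((a : ℤ) - b) c ≤ ((a : ℤ) - b).natAbs :=
    Nat.le_of_dvd hpos (Int.gcd_dvd_natAbs_left _ _)
  have h₁ : a ≤ a * b := Nat.le_mul_of_pos_right a hb
  have h₂ : b ≤ a * b := Nat.le_mul_of_pos_left b ha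
  omega

/-- Modulo the gcd, `n` is inverse to `p ^ s`, so the gcd divides `n * p ^ s - 1`. -/
theorem Int.gcd_sub_pow_dvd_mul_pow_sub_one (n p : ℤ) (s t : ℕ) :
    (Int.gcd (n - p ^ t) (p ^ (t + s) - 1) : ℤ) ∣ n * p ^ s - 1 := by
  have h : n * p ^ s - 1 = (n - p ^ t) * p ^ s + (p ^ (t + s) - 1) := by ring
  rw [h]
  exact dvd_add ((Int.gcd_dvd_left _ _).mul_right _) (Int.gcd_dvd_right _ _)

/-- Let `n ≥ 1`, `p ≥ 2`, `d ≥ 2`, `1 ≤ t ≤ d - 1` be integers with `n ≠ p^t`.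
Then `gcd(n - p^t, p^d - 1) ≤ n · p^(d/2)`. -/
theorem stmt_6 (n p d t : ℕ) (hn : 1 ≤ n) (hp : 2 ≤ p) (hd : 2 ≤ d)
    (ht1 : 1 ≤ t) (ht2 : t ≤ d - 1) (hne : n ≠ p ^ t) :
    (Int.gcd ((n : ℤ) - (p : ℤ) ^ t) ((p : ℤ) ^ d - 1) : ℝ) ≤
      (n : ℝ) * (p : ℝ) ^ ((d : ℝ) / 2) := by
  obtain ⟨s, rfl⟩ : ∃ s, d = t + s := ⟨d - t, by omega⟩
  have hs : s ≠ 0 := by omega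
  have key : ∃ k : ℕ, 2 * k ≤ t + s ∧
      Int.gcd ((n : ℤ) - (p : ℤ) ^ t) ((p : ℤ) ^ (t + s) - 1) ≤ n * p ^ k := by
    rcases le_total t s with hts | hst
    · refine ⟨t, by omega, ?_⟩
      exact_mod_cast Int.gcd_natCast_sub_natCast_le_mul hn (Nat.one_le_pow _ _ (by omega)) hne _
    · refine ⟨s, by omega, ?_⟩
      have h₁ : 1 < n * p ^ s :=
        (Nat.one_lt_pow hs hp).trans_le (Nat.le_mul_of_pos_left _ hn)
      have h₂ : (1 : ℤ) < (n : ℤ) * (p : ℤ) ^ s := by exact_mod_cast h₁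
      have h₃ := Int.le_of_dvd (by omega) (Int.gcd_sub_pow_dvd_mul_pow_sub_one n p s t)
      zify
      omega
  obtain ⟨k, hk, hle⟩ := key
  have hk' : (2 : ℝ) * k ≤ ((t + s : ℕ) : ℝ) := by exact_mod_cast hk
  have hp' : (1 : ℝ) ≤ p := by exact_mod_cast (by omega : 1 ≤ p)
  calc (Int.gcd ((n : ℤ) - (p : ℤ) ^ t) ((p : ℤ) ^ (t + s) - 1) : ℝ)
      ≤ (n : ℝ) * (p : ℝ) ^ k := by exact_mod_cast hle
    _ = (n : ℝ) * (p : ℝ) ^ (k : ℝ) := by rw [Real.rpow_natCast]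
    _ ≤ (n : ℝ) * (p : ℝ) ^ (((t + s : ℕ) : ℝ) / 2) := by
      gcongr
      linarith
end

section
/- Let p be a prime, v ≥ 1 an integer, and S a commutative ring in which (p·1_S)^v = 0. Let n ≥ 1 and d ≥ 1 be integers with p dividing n. If x ∈ S satisfies x − 1 ∈ pS (the ideal of S generated by p·1_S) and x^{n^d} = x, then x = 1. -/
/-- Let `p` be a prime, `v ≥ 1`, and `S` a commutative ring in which `(p·1)^v = 0`.
Let `n ≥ 1` and `d ≥ 1` with `p ∣ n`. If `x ∈ S` satisfies `x - 1 ∈ pS` and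
`x^(n^d) = x`, then `x = 1`. -/
theorem stmt_9 (p : ℕ) (hp : p.Prime) (v : ℕ) (hv : 1 ≤ v)
    (S : Type*) [CommRing S] (hnilp : ((p : S)) ^ v = 0)
    (n d : ℕ) (hn : 1 ≤ n) (hd : 1 ≤ d) (hpn : p ∣ n)
    (x : S) (hx1 : x - 1 ∈ Ideal.span {(p : S)}) (hx : x ^ (n ^ d) = x) :
    x = 1 := by
  have hiter : ∀ k : ℕ, x ^ ((n ^ d) ^ k) = x := by
    intro k
    induction k with
    | zero => simp
    | succ k ih => rw [pow_succ, pow_mul, ih, hx]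
  have hpow : x ^ (p ^ v) = 1 := by
    have h := dvd_sub_pow_of_dvd_sub (Ideal.mem_span_singleton.mp hx1) v
    rw [pow_succ, hnilp, zero_mul, zero_dvd_iff, one_pow] at h
    exact sub_eq_zero.mp h
  obtain ⟨m, hm⟩ := pow_dvd_pow_of_dvd (hpn.trans (dvd_pow_self n (by omega : d ≠ 0))) v
  rw [← hiter v, hm, pow_mul, hpow, one_pow]
end

section
/- Let p be an odd prime, v ≥ 1 an integer, and S a commutative ring in which (p·1_S)^v = 0. Let U = {x ∈ S* : x − 1 ∈ pS}, a subgroup of the group S* of units of S. Then there exists a group isomorphism Exp from the additive group (pS, +) onto the multiplicative group U such that for every ring homomorphism σ : S → S and every y ∈ pS one has σ(Exp(y)) = Exp(σ(y)). -/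
open Finset

lemma two_mul_padicValNat_factorial_lt {p : ℕ} (hp : p.Prime) (hodd : Odd p) {n : ℕ}
    (hn : n ≠ 0) : 2 * padicValNat p n.factorial < n := by
  have : Fact p.Prime := ⟨hp⟩
  have hp2 : 2 ≤ p - 1 := by
    have := hp.two_le
    obtain ⟨m, rfl⟩ := hodd
    omega
  exact (Nat.mul_le_mul_right _ hp2).trans_lt
    (sub_one_mul_padicValNat_factorial_lt_of_ne_zero p hn)

lemma PadicInt.pow_mul_factorial_dvd_pow {p : ℕ} [hp : Fact p.Prime] {k n : ℕ}
    (hkn : k + padicValNat p n.factorial ≤ n) :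
    (p : ℤ_[p]) ^ k * (n.factorial : ℤ_[p]) ∣ (p : ℤ_[p]) ^ n := by
  obtain ⟨m, hm⟩ := pow_padicValNat_dvd (p := p) (n := n.factorial)
  have hpm : ¬ p ∣ m := by
    intro h
    apply pow_succ_padicValNat_not_dvd (p := p) n.factorial_ne_zero
    conv_rhs => rw [hm]
    exact mul_dvd_mul_left _ h
  have hunit : IsUnit (m : ℤ_[p]) := by
    rw [PadicInt.isUnit_iff]
    exact PadicInt.norm_natCast_eq_one_iff.2 ((Nat.Prime.coprime_iff_not_dvd hp.out).2 hpm)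
  rw [hm, Nat.cast_mul, ← mul_assoc, hunit.mul_right_dvd, Nat.cast_pow, ← pow_add]
  exact pow_dvd_pow _ hkn

/-- The numbers `p ^ n / n!`, mapped to a ring in which `p ^ v = 0`. -/
lemma exists_dividedPower_coeff {p : ℕ} (hp : p.Prime) (hodd : Odd p) (v : ℕ)
    {S : Type*} [CommRing S] (hnilp : (p : S) ^ v = 0) :
    ∃ c : ℕ → S, c 0 = 1 ∧ c 1 = p ∧
      (∀ i j, c i * c j = (i + j).choose i * c (i + j)) ∧
      (∀ n, (p : S) ^ 2 ∣ c (n + 2)) ∧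
      (∀ n, 2 * v + 2 ≤ n → c n = 0) ∧
      ∀ (σ : S →+* S) n, σ (c n) = c n := by
  have : Fact p.Prime := ⟨hp⟩
  have hval : ∀ n ≠ 0, 2 * padicValNat p n.factorial < n := fun n =>
    two_mul_padicValNat_factorial_lt hp hodd
  have hdvd : ∀ n, (n.factorial : ℤ_[p]) ∣ (p : ℤ_[p]) ^ n := fun n => by
    simpa using PadicInt.pow_mul_factorial_dvd_pow (p := p) (k := 0)
      (by simpa using padicValNat_factorial_le p n)
  choose e he using hdvd
  have hfac : ∀ n : ℕ, (n.factorial : ℤ_[p]) ≠ 0 := fun n => by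
    exact_mod_cast n.factorial_ne_zero
  have hpow : ∀ k n : ℕ, k + padicValNat p n.factorial ≤ n → (p : ℤ_[p]) ^ k ∣ e n := by
    intro k n h
    have := PadicInt.pow_mul_factorial_dvd_pow h
    rw [he n, mul_comm] at this
    exact (mul_dvd_mul_iff_left (hfac n)).1 this
  have hchar : ringChar S ∣ p ^ v := by
    rw [← CharP.cast_eq_zero_iff S (ringChar S)]
    exact_mod_cast hnilp
  let ψ : ZMod (p ^ v) →+* S := ZMod.castHom hchar S
  let φ : ℤ_[p] →+* S := ψ.comp (PadicInt.toZModPow v)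
  refine ⟨fun n => φ (e n), ?_, ?_, fun i j => ?_, fun n => ?_, fun n hn => ?_, fun σ n => ?_⟩
  · have := he 0
    simp only [pow_zero, Nat.factorial_zero, Nat.cast_one, one_mul] at this
    simp [← this]
  · have := he 1
    simp only [pow_one, Nat.factorial_one, Nat.cast_one, one_mul] at this
    simp [← this]
  · have : e i * e j = (i + j).choose i * e (i + j) := by
      have h1 := Nat.add_choose_mul_factorial_mul_factorial i j
      have h2 : ((i + j).choose i : ℤ_[p]) * i.factorial * j.factorial = (i + j).factorial := by
        exact_mod_cast Nat.choose_symm_add (a := i) (b := j) ▸ h1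
      apply mul_left_cancel₀ (mul_ne_zero (hfac i) (hfac j))
      calc _ = (i.factorial * e i) * (j.factorial * e j) := by ring
        _ = (p : ℤ_[p]) ^ (i + j) := by rw [← he, ← he, pow_add]
        _ = _ := by rw [he, ← h2]; ring
    simp only [← map_mul, this]
    simp
  · simpa using map_dvd φ (hpow 2 (n + 2) (by have := hval (n + 2); omega))
  · simpa [hnilp] using map_dvd φ (hpow v n (by have := hval n; omega))
  · exact congrArg (fun f : ZMod (p ^ v) →+* S => f (PadicInt.toZModPow v (e n)))
      (Subsingleton.elim (σ.comp ψ) ψ)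

/-- If `c i * c j = (i + j).choose i * c (i + j)`, then `∑ c n * s ^ n` turns addition into
multiplication. -/
lemma sum_mul_sum_of_dividedPower_coeff {S : Type*} [CommRing S] {c : ℕ → S} {N : ℕ}
    (hc : ∀ i j, c i * c j = (i + j).choose i * c (i + j)) (hN : ∀ n, N ≤ n → c n = 0) (s t : S) :
    (∑ n ∈ range N, c n * s ^ n) * ∑ n ∈ range N, c n * t ^ n =
      ∑ n ∈ range N, c n * (s + t) ^ n := by
  let P : S → Polynomial S := fun s => ∑ n ∈ range N, Polynomial.monomial n (c n * s ^ n)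
  have hcoeff : ∀ s n, (P s).coeff n = c n * s ^ n := by
    intro s n
    simp only [P, Polynomial.finsetSum_coeff, Polynomial.coeff_monomial, sum_ite_eq', mem_range]
    split_ifs with h
    · rfl
    · rw [hN n (not_lt.1 h), zero_mul]
  have heval : ∀ s, (P s).eval 1 = ∑ n ∈ range N, c n * s ^ n := by
    intro s
    simp [P, Polynomial.eval_finsetSum]
  have hmul : P s * P t = P (s + t) := by
    ext n
    rw [Polynomial.coeff_mul, hcoeff, (Commute.all s t).add_pow', mul_sum]
    refine sum_congr rfl fun x hx => ?_
    rw [HasAntidiagonal.mem_antidiagonal] at hx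
    rw [hcoeff, hcoeff, ← hx, nsmul_eq_mul]
    linear_combination s ^ x.1 * t ^ x.2 * hc x.1 x.2
  rw [← heval, ← heval, ← heval, ← hmul, Polynomial.eval_mul]

lemma mul_pow_eq_mul_pow_of_mul_eq_mul {M : Type*} [CommMonoid M] {q s t : M}
    (h : q * s = q * t) (n : ℕ) : q * s ^ n = q * t ^ n := by
  induction n with
  | zero => simp
  | succ n ih => rw [pow_succ, ← mul_assoc, ih, mul_right_comm, h, mul_right_comm, mul_assoc,
      ← pow_succ]


/-- Let `p` be an odd prime, `v ≥ 1`, and `S` a commutative ring with `(p·1)^v = 0`.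
Let `U = {x ∈ Sˣ : x - 1 ∈ pS}`. Then there is a group isomorphism `Exp` from the
additive group `(pS, +)` onto the multiplicative group `U`, equivariant under every
ring endomorphism `σ` of `S` (i.e. `σ(Exp y) = Exp(σ y)` for `y ∈ pS`). -/
theorem stmt_10 (p : ℕ) (hp : p.Prime) (hodd : Odd p) (v : ℕ) (hv : 1 ≤ v)
    (S : Type*) [CommRing S] (hnilp : ((p : S)) ^ v = 0) :
    ∃ Exp : (Ideal.span {(p : S)} : Ideal S) → Sˣ,
      Function.Injective Exp ∧
      (∀ y, ((Exp y : Sˣ) : S) - 1 ∈ Ideal.span {(p : S)}) ∧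
      (∀ x : Sˣ, (x : S) - 1 ∈ Ideal.span {(p : S)} → ∃ y, Exp y = x) ∧
      (∀ a b, Exp (a + b) = Exp a * Exp b) ∧
      (∀ σ : S →+* S, ∀ y z : (Ideal.span {(p : S)} : Ideal S),
        (z : S) = σ (y : S) → σ ((Exp y : Sˣ) : S) = ((Exp z : Sˣ) : S)) := by
  obtain ⟨c, hc0, hc1, hmul, hsq, hzero, hσ⟩ := exists_dividedPower_coeff hp hodd v hnilp
  let E : S → S := fun s => ∑ n ∈ range (2 * v + 2), c n * s ^ n
  have hE_add : ∀ s t, E (s + t) = E s * E t := fun s t =>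
    (sum_mul_sum_of_dividedPower_coeff hmul hzero s t).symm
  have hE_zero : E 0 = 1 := by
    simp [E, sum_range_succ', hc0]
  have hE_form : ∀ s, ∃ w, E s = 1 + p * s * (1 + p * w) := by
    intro s
    choose d hd using hsq
    refine ⟨∑ n ∈ range (2 * v), d n * s ^ (n + 1), ?_⟩
    have : ∑ n ∈ range (2 * v), c (n + 2) * s ^ (n + 2) =
        p * s * (p * ∑ n ∈ range (2 * v), d n * s ^ (n + 1)) := by
      simp only [mul_sum]
      refine sum_congr rfl fun n _ => ?_
      rw [hd]
      ring
    simp only [E, sum_range_succ', this, hc0, hc1, zero_add]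
    ring
  have hE_congr : ∀ s t, (p : S) * s = p * t → E s = E t := by
    intro s t hst
    refine sum_congr rfl fun n _ => ?_
    have hdvd : n = 0 ∨ (p : S) ∣ c n := by
      match n with
      | 0 => exact .inl rfl
      | 1 => exact .inr hc1.symm.dvd
      | n + 2 => exact .inr ((dvd_pow_self _ two_ne_zero).trans (hsq n))
    obtain rfl | ⟨d, hd⟩ := hdvd
    · simp
    · rw [hd, mul_right_comm, mul_pow_eq_mul_pow_of_mul_eq_mul hst, mul_right_comm]
  have hE_inv : ∀ s, E s * E (-s) = 1 := fun s => by rw [← hE_add, add_neg_cancel, hE_zero]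
  let F : S → Sˣ := fun s => ⟨E s, E (-s), hE_inv s, by rw [mul_comm, hE_inv]⟩
  have hroot : ∀ y : (Ideal.span {(p : S)} : Ideal S), ∃ s, (y : S) = p * s := fun y =>
    Ideal.mem_span_singleton.1 y.2
  choose r hr using hroot
  have hr_eq : ∀ (y : (Ideal.span {(p : S)} : Ideal S)) s, (y : S) = p * s → F (r y) = F s := fun y s h =>
    Units.ext (hE_congr _ _ ((hr y).symm.trans h))
  have hF_add : ∀ s t, F (s + t) = F s * F t := fun s t => Units.ext (hE_add s t)
  have hF_ker : ∀ s, F s = 1 → (p : S) * s = 0 := by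
    intro s hs
    obtain ⟨w, hw⟩ := hE_form s
    have hunit : IsUnit (1 + (p : S) * w) :=
      IsNilpotent.isUnit_one_add ⟨v, by rw [mul_pow, hnilp, zero_mul]⟩
    have h1 : E s = 1 := congrArg Units.val hs
    rw [h1, left_eq_add] at hw
    exact hunit.mul_left_eq_zero.1 hw
  have hF_sub : ∀ s t, F s = F t → (p : S) * s = p * t := by
    intro s t h
    have := hF_ker (s - t) (by
      rw [← mul_left_inj (F t), ← hF_add, sub_add_cancel, h, one_mul])
    rwa [mul_sub, sub_eq_zero] at this
  have hF_surj : ∀ k l, 1 ≤ k → k + l = v → ∀ x : Sˣ, (p : S) ^ k ∣ x - 1 → ∃ s, F s = x := by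
    intro k l
    induction l generalizing k with
    | zero =>
      rintro - rfl x hx
      rw [add_zero] at hnilp
      rw [hnilp, zero_dvd_iff, sub_eq_zero] at hx
      exact ⟨0, Units.ext (hE_zero.trans hx.symm)⟩
    | succ l ih =>
      rintro hk hkl x ⟨t, ht⟩
      obtain ⟨k, rfl⟩ := Nat.exists_eq_add_of_le' hk
      obtain ⟨w, hw⟩ := hE_form (-((p : S) ^ k * t))
      obtain ⟨s, hs⟩ := ih (k + 1 + 1) (by omega) (by omega) (x * F (-((p : S) ^ k * t))) (by
        rw [Units.val_mul, show (F (-((p : S) ^ k * t)) : S) = _ from hw, sub_eq_iff_eq_add.1 ht]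
        refine ⟨-(p ^ k * t ^ 2) - t * w * (1 + p ^ (k + 1) * t), ?_⟩
        ring)
      refine ⟨s + (p : S) ^ k * t, ?_⟩
      rw [hF_add, hs, mul_assoc, ← hF_add, neg_add_cancel, show F 0 = 1 from Units.ext hE_zero,
        mul_one]
  refine ⟨fun y => F (r y), fun y z h => ?_, fun y => ?_, fun x hx => ?_, fun a b => ?_,
    fun σ y z h => ?_⟩
  · exact Subtype.ext (by rw [hr, hr z, hF_sub _ _ h])
  · obtain ⟨w, hw⟩ := hE_form (r y)
    refine Ideal.mem_span_singleton.2 ⟨r y * (1 + p * w), ?_⟩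
    rw [show (F (r y) : S) = _ from hw]
    ring
  · obtain ⟨s, rfl⟩ := hF_surj 1 (v - 1) le_rfl (by omega) x
      (by simpa using Ideal.mem_span_singleton.1 hx)
    exact ⟨⟨p * s, Ideal.mem_span_singleton.2 ⟨s, rfl⟩⟩, hr_eq _ _ rfl⟩
  · rw [← hF_add]
    exact hr_eq _ _ (by rw [Submodule.coe_add, hr, hr b, mul_add])
  · dsimp only
    rw [hr_eq z (σ (r y)) (by rw [h, hr, map_mul, map_natCast])]
    simp [F, E, hσ]
end

section
/- Let R be a commutative ring, d ≥ 1 an integer, a a unit of R, and ζ ∈ R an element with ζ^d = 1 such that ζ^i − 1 is a unit of R for every i with 0 < i < d. Let S = R[Y]/(Y^d − a), let y denote the image of Y in S, and let τ : S → S be the R-algebra endomorphism determined by τ(y) = ζ·y (which exists since (ζy)^d = a). Then the fixed subalgebra {s ∈ S : τ(s) = s} equals the image of R in S, i.e. τ(s) = s if and only if s lies in the range of the structure map R → S. -/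
open Polynomial in
/-- Every class modulo a monic polynomial has a representative of smaller degree. -/
theorem exists_mk_eq_degree_lt {R : Type*} [CommRing R] [Nontrivial R] {g : R[X]}
    (hg : g.Monic) (s : AdjoinRoot g) :
    ∃ p : R[X], AdjoinRoot.mk g p = s ∧ p.degree < g.degree := by
  obtain ⟨q, rfl⟩ := AdjoinRoot.mk_surjective s
  refine ⟨q %ₘ g, ?_, degree_modByMonic_lt q hg⟩
  rw [← AdjoinRoot.modByMonicHom_mk hg, AdjoinRoot.mk_leftInverse hg]

open Polynomial in
/-- Let `R` be a commutative ring, `d ≥ 1`, `a` a unit of `R`, and `ζ ∈ R` with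
`ζ^d = 1` such that `ζ^i - 1` is a unit for `0 < i < d`. Let `S = R[Y]/(Y^d - a)`,
`y` the image of `Y`, and `τ : S → S` the `R`-algebra endomorphism with `τ(y) = ζ·y`.
Then the fixed subalgebra `{s ∈ S : τ(s) = s}` equals the image of `R` in `S`. -/
theorem stmt_11 (R : Type*) [CommRing R] (d : ℕ) (hd : 1 ≤ d)
    (a : Rˣ) (ζ : R) (hζd : ζ ^ d = 1)
    (hζ : ∀ i : ℕ, 0 < i → i < d → IsUnit (ζ ^ i - 1))
    (τ : AdjoinRoot (Polynomial.X ^ d - Polynomial.C (a : R)) →ₐ[R]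
         AdjoinRoot (Polynomial.X ^ d - Polynomial.C (a : R)))
    (hτ : τ (AdjoinRoot.root (Polynomial.X ^ d - Polynomial.C (a : R))) =
      algebraMap R (AdjoinRoot (Polynomial.X ^ d - Polynomial.C (a : R))) ζ *
        AdjoinRoot.root (Polynomial.X ^ d - Polynomial.C (a : R))) :
    ∀ s : AdjoinRoot (Polynomial.X ^ d - Polynomial.C (a : R)),
      τ s = s ↔
        s ∈ Set.range (algebraMap R (AdjoinRoot (Polynomial.X ^ d - Polynomial.C (a : R)))) := by
  intro s
  refine ⟨fun hs => ?_, ?_⟩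
  swap
  · rintro ⟨r, rfl⟩
    exact τ.commutes r
  cases subsingleton_or_nontrivial R
  · have := Module.subsingleton R (AdjoinRoot (X ^ d - C (a : R)))
    exact ⟨0, Subsingleton.elim _ _⟩
  have hmonic : (X ^ d - C (a : R)).Monic := monic_X_pow_sub_C _ (by lia)
  obtain ⟨p, rfl, hp⟩ := exists_mk_eq_degree_lt hmonic s
  rw [degree_X_pow_sub_C (by lia)] at hp
  have hτp : τ (AdjoinRoot.mk _ p) = AdjoinRoot.mk _ (p.comp (C ζ * X)) := by
    rw [← AdjoinRoot.aeval_eq, ← AdjoinRoot.aeval_eq, ← aeval_algHom_apply, hτ, aeval_comp]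
    simp
  have hcoeff (i : ℕ) : (p.comp (C ζ * X)).coeff i = p.coeff i * ζ ^ i := comp_C_mul_X_coeff
  have hcomp : (p.comp (C ζ * X)).degree < d := by
    rw [degree_lt_iff_coeff_zero] at hp ⊢
    intro i hi
    rw [hcoeff, hp i hi, zero_mul]
  have hfix : p.comp (C ζ * X) = p := by
    rw [hτp, AdjoinRoot.mk_eq_mk] at hs
    refine sub_eq_zero.mp (by_contra fun hne => hmonic.not_dvd_of_degree_lt hne ?_ hs)
    rw [degree_X_pow_sub_C (by lia)]
    exact (degree_sub_le _ _).trans_lt (max_lt hcomp hp)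
  have hconst : p = C (p.coeff 0) := by
    ext i
    rcases Nat.eq_zero_or_pos i with rfl | hi
    · simp
    rw [coeff_C_of_ne_zero hi.ne']
    rcases lt_or_ge i d with hid | hid
    · rw [← (hζ i hi hid).mul_left_eq_zero, mul_sub, mul_one, ← hcoeff, hfix, sub_self]
    · exact (degree_lt_iff_coeff_zero _ _).mp hp i hid
  exact ⟨p.coeff 0, by rw [hconst]; simp [AdjoinRoot.algebraMap_eq]⟩
end
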